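/- Let α > 0 be a real number. For n > 1 let p(n) denote the smallest prime divisor of n, P(n) the largest prime divisor of n, ω(n) the number of distinct prime divisors of n, and μ the Möbius function. Then as x → ∞, Σ_{1 < n ≤ x, μ(n) ≠ 0, ω(n) = 3} (p(n)/P(n))^α = (9/α²)·x/(log x)^3 + O(x/(log x)^4). Equivalently, Σ_{p₁ < p₂ < p₃ primes, p₁p₂p₃ ≤ x} (p₁/p₃)^α has this asymptotic. -/

import Mathlib

open Filter Finset

section ZetaBound
open Complex MeasureTheory Topology Asymptotics

lemma measurable_fract_ioi :
    Measurable (fun t : ℝ => (Set.Ioi (1 : ℝ)).indicator (fun t => ((Int.fract t : ℝ) : ℂ)) t) := by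
  apply Measurable.indicator _ measurableSet_Ioi
  fun_prop

lemma norm_fract_ioi_le (t : ℝ) :
    ‖(Set.Ioi (1 : ℝ)).indicator (fun t => ((Int.fract t : ℝ) : ℂ)) t‖ ≤ 1 := by
  by_cases h : t ∈ Set.Ioi (1 : ℝ)
  · rw [Set.indicator_of_mem h, Complex.norm_real, Real.norm_eq_abs, abs_of_nonneg (Int.fract_nonneg _)]
    exact (Int.fract_lt_one _).le
  · rw [Set.indicator_of_notMem h]; simp

lemma locallyIntegrable_fract_ioi :
    LocallyIntegrable (fun t : ℝ => (Set.Ioi (1 : ℝ)).indicator (fun t => ((Int.fract t : ℝ) : ℂ)) t) := by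
  refine (locallyIntegrable_const (1 : ℝ)).mono measurable_fract_ioi.aestronglyMeasurable ?_
  filter_upwards with t
  simpa using norm_fract_ioi_le t

lemma fract_ioi_isBigO_top :
    (fun t : ℝ => (Set.Ioi (1 : ℝ)).indicator (fun t => ((Int.fract t : ℝ) : ℂ)) t) =O[atTop]
      (fun t : ℝ => t ^ (-(0 : ℝ))) := by
  refine IsBigO.of_bound 1 ?_
  filter_upwards with t
  simpa using norm_fract_ioi_le t

lemma fract_ioi_isBigO_zero (b : ℝ) :
    (fun t : ℝ => (Set.Ioi (1 : ℝ)).indicator (fun t => ((Int.fract t : ℝ) : ℂ)) t) =O[𝓝[>] 0]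
      (fun t : ℝ => t ^ (-b)) := by
  refine IsBigO.of_bound 1 ?_
  have : ∀ᶠ t : ℝ in 𝓝[>] 0, t < 1 := nhdsWithin_le_nhds (eventually_lt_nhds one_pos)
  filter_upwards [this] with t ht
  rw [Set.indicator_of_notMem (by simpa using ht.le)]
  simp

lemma mellin_fract_ioi (s : ℂ) :
    mellin (fun t : ℝ => (Set.Ioi (1 : ℝ)).indicator (fun t => ((Int.fract t : ℝ) : ℂ)) t) (-s)
      = ∫ t in Set.Ioi (1 : ℝ), ((Int.fract t : ℝ) : ℂ) * (t : ℂ) ^ (-(s + 1)) := by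
  rw [mellin]
  have : ∀ t : ℝ, (t : ℂ) ^ (-s - 1) •
      (Set.Ioi (1 : ℝ)).indicator (fun t => ((Int.fract t : ℝ) : ℂ)) t =
      (Set.Ioi (1 : ℝ)).indicator
        (fun t => ((Int.fract t : ℝ) : ℂ) * (t : ℂ) ^ (-(s + 1))) t := by
    intro t
    by_cases h : t ∈ Set.Ioi (1 : ℝ)
    · rw [Set.indicator_of_mem h, Set.indicator_of_mem h, smul_eq_mul, mul_comm]
      congr 2; ring
    · rw [Set.indicator_of_notMem h, Set.indicator_of_notMem h, smul_zero]
  simp_rw [this]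
  rw [setIntegral_indicator measurableSet_Ioi]
  congr 2
  ext t; simp

lemma integrableOn_fract_cpow {s : ℂ} (hs : 0 < s.re) :
    IntegrableOn (fun t : ℝ => ((Int.fract t : ℝ) : ℂ) * (t : ℂ) ^ (-(s + 1))) (Set.Ioi (1 : ℝ)) := by
  have h : IntegrableOn (fun t : ℝ => (t : ℂ) ^ (-(s + 1))) (Set.Ioi (1 : ℝ)) :=
    integrableOn_Ioi_cpow_of_lt (by simp; linarith) one_pos
  refine h.norm.mono' ?_ ?_
  · refine AEStronglyMeasurable.mul ?_ h.aestronglyMeasurable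
    exact (by fun_prop : Measurable fun t : ℝ => ((Int.fract t : ℝ) : ℂ)).aestronglyMeasurable
  · filter_upwards with t
    rw [norm_mul, Complex.norm_real, Real.norm_eq_abs, abs_of_nonneg (Int.fract_nonneg _)]
    exact mul_le_of_le_one_left (norm_nonneg _) (Int.fract_lt_one _).le

lemma floor_eq_sub_fract {t : ℝ} (ht : 0 ≤ t) :
    ((⌊t⌋₊ : ℕ) : ℂ) = (t : ℂ) - ((Int.fract t : ℝ) : ℂ) := by
  have h : (⌊t⌋₊ : ℝ) = t - Int.fract t := by
    rw [natCast_floor_eq_intCast_floor ht]; exact (Int.self_sub_fract t).symm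
  exact_mod_cast congrArg (fun x : ℝ => (x : ℂ)) h

lemma riemannZeta_eq_mul_integral_floor {s : ℂ} (hs : 1 < s.re) :
    riemannZeta s = s * ∫ t in Set.Ioi (1 : ℝ), ((⌊t⌋₊ : ℕ) : ℂ) * (t : ℂ) ^ (-(s + 1)) := by
  rw [← LSeries_one_eq_riemannZeta hs, LSeries_eq_mul_integral 1 zero_le_one hs
    (LSeriesSummable_one_iff.mpr hs)]
  · simp
  · refine IsBigO.of_bound 1 ?_
    filter_upwards with n
    simp

lemma riemannZeta₀_eq_of_one_lt {s : ℂ} (hs : 1 < s.re) :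
    riemannZeta₀ s = 1 - s * ∫ t in Set.Ioi (1 : ℝ), ((Int.fract t : ℝ) : ℂ) * (t : ℂ) ^ (-(s + 1)) := by
  have hs1 : s ≠ 1 := by rintro rfl; simp at hs
  have h1 := riemannZeta_eq_inv_sub_add hs1
  rw [riemannZeta_eq_mul_integral_floor hs] at h1
  have h2 : ∫ t in Set.Ioi (1 : ℝ), ((⌊t⌋₊ : ℕ) : ℂ) * (t : ℂ) ^ (-(s + 1)) =
      (∫ t in Set.Ioi (1 : ℝ), (t : ℂ) ^ (-s)) -
        ∫ t in Set.Ioi (1 : ℝ), ((Int.fract t : ℝ) : ℂ) * (t : ℂ) ^ (-(s + 1)) := by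
    rw [← integral_sub (integrableOn_Ioi_cpow_of_lt (by simp; linarith) one_pos)
      (integrableOn_fract_cpow (by linarith))]
    refine setIntegral_congr_fun measurableSet_Ioi fun t ht => ?_
    have ht0 : (0 : ℝ) < t := lt_trans one_pos ht
    have : (t : ℂ) ^ (-s) = (t : ℂ) * (t : ℂ) ^ (-(s + 1)) := by
      rw [show -s = 1 + -(s + 1) by ring, cpow_add _ _ (by exact_mod_cast ht0.ne'), cpow_one]
    simp only [this]
    rw [floor_eq_sub_fract ht0.le]; ring
  rw [h2, integral_Ioi_cpow_of_lt (by simp; linarith) one_pos] at h1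
  have h3 : s - 1 ≠ 0 := sub_ne_zero.mpr hs1
  have h4 : -s + 1 ≠ 0 := by rw [show -s + 1 = -(s - 1) by ring]; exact neg_ne_zero.mpr h3
  have h5 : s * (-((1 : ℝ) : ℂ) ^ (-s + 1) / (-s + 1)) = (s - 1)⁻¹ + 1 := by
    rw [ofReal_one, one_cpow]; field_simp; ring
  linear_combination -h1 + h5

lemma riemannZeta₀_eq {s : ℂ} (hs : 0 < s.re) :
    riemannZeta₀ s = 1 - s * ∫ t in Set.Ioi (1 : ℝ), ((Int.fract t : ℝ) : ℂ) * (t : ℂ) ^ (-(s + 1)) := by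
  have hU : IsOpen {z : ℂ | 0 < z.re} := isOpen_lt continuous_const continuous_re
  have h1 : AnalyticOnNhd ℂ riemannZeta₀ {z : ℂ | 0 < z.re} :=
    (differentiable_riemannZeta₀.differentiableOn).analyticOnNhd hU
  have h2 : AnalyticOnNhd ℂ (fun s : ℂ => 1 - s * mellin (fun t : ℝ => (Set.Ioi (1 : ℝ)).indicator
      (fun t => ((Int.fract t : ℝ) : ℂ)) t) (-s)) {z : ℂ | 0 < z.re} := by
    refine DifferentiableOn.analyticOnNhd (fun z hz => ?_) hU
    have hz' : 0 < z.re := hz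
    refine DifferentiableAt.differentiableWithinAt ?_
    refine (differentiableAt_const _).sub (differentiableAt_id.mul ?_)
    refine DifferentiableAt.comp z (g := mellin _) ?_ differentiableAt_id.neg
    exact mellin_differentiableAt_of_isBigO_rpow (a := 0) (b := -z.re - 1)
      (locallyIntegrable_fract_ioi.locallyIntegrableOn _) fract_ioi_isBigO_top (by simpa using hz')
      (fract_ioi_isBigO_zero _) (by simp)
  have h3 : IsPreconnected {z : ℂ | 0 < z.re} := (convex_halfSpace_re_gt 0).isPreconnected
  have h4 := h1.eqOn_of_preconnected_of_eventuallyEq h2 h3 (z₀ := 2) (by simp) (by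
    have : ∀ᶠ z : ℂ in 𝓝 2, 1 < z.re :=
      (isOpen_lt continuous_const continuous_re).mem_nhds (by simp)
    filter_upwards [this] with z hz
    rw [riemannZeta₀_eq_of_one_lt hz, mellin_fract_ioi])
  have := h4 hs
  simp only [mellin_fract_ioi] at this
  exact this

lemma riemannZeta_eq_sum_add {s : ℂ} (hs : 0 < s.re) (hs1 : s ≠ 1) (N : ℕ) :
    riemannZeta s = ∑ n ∈ Finset.range (N + 1), ((n + 1 : ℕ) : ℂ) ^ (-s)
      + ((N + 1 : ℕ) : ℂ) ^ (1 - s) / (s - 1)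
      - s * ∫ t in Set.Ioi ((N + 1 : ℕ) : ℝ), ((Int.fract t : ℝ) : ℂ) * (t : ℂ) ^ (-(s + 1)) := by
  have h3 : s - 1 ≠ 0 := sub_ne_zero.mpr hs1
  have hs0 : s ≠ 0 := by rintro rfl; simp at hs
  induction N with
  | zero =>
    rw [riemannZeta_eq_inv_sub_add hs1, riemannZeta₀_eq hs]
    simp
    ring
  | succ N ih =>
    rw [ih, Finset.sum_range_succ _ (N + 1)]
    have hN : (0 : ℝ) < ((N + 1 : ℕ) : ℝ) := by positivity
    have hN1 : ((N + 1 : ℕ) : ℝ) ≤ ((N + 1 + 1 : ℕ) : ℝ) := by push_cast; linarith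
    have hI := (integrableOn_fract_cpow hs).mono_set
      (Set.Ioi_subset_Ioi (show (1 : ℝ) ≤ ((N + 1 : ℕ) : ℝ) by push_cast; linarith [N.cast_nonneg (α := ℝ)]))
    rw [← Set.Ioc_union_Ioi_eq_Ioi hN1, setIntegral_union Set.Ioc_disjoint_Ioi_same measurableSet_Ioi
      (hI.mono_set Set.Ioc_subset_Ioi_self) (hI.mono_set (Set.Ioi_subset_Ioi hN1))]
    have e1 : ∫ t in Set.Ioc ((N + 1 : ℕ) : ℝ) ((N + 1 + 1 : ℕ) : ℝ),
        ((Int.fract t : ℝ) : ℂ) * (t : ℂ) ^ (-(s + 1)) =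
        ∫ t in ((N + 1 : ℕ) : ℝ)..((N + 1 + 1 : ℕ) : ℝ), ((t : ℂ) ^ (-s) - ((N + 1 : ℕ) : ℂ) * (t : ℂ) ^ (-s-1)) := by
      rw [intervalIntegral.integral_of_le hN1, integral_Ioc_eq_integral_Ioo, integral_Ioc_eq_integral_Ioo]
      refine setIntegral_congr_fun measurableSet_Ioo fun t ht => ?_
      have ht0 : (0 : ℝ) < t := lt_trans hN ht.1
      have hf : Int.fract t = t - ((N + 1 : ℕ) : ℝ) := by
        rw [Int.fract_eq_iff]
        refine ⟨by linarith [ht.1], ?_, (N + 1 : ℕ), by push_cast; ring⟩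
        have := ht.2
        push_cast at this ⊢
        linarith
      have : (t : ℂ) ^ (-s) = (t : ℂ) * (t : ℂ) ^ (-(s + 1)) := by
        rw [show -s = 1 + -(s + 1) by ring, cpow_add _ _ (by exact_mod_cast ht0.ne'), cpow_one]
      simp only [this, hf, show -s - 1 = -(s + 1) by ring]
      push_cast; ring
    have hnot : (0 : ℝ) ∉ Set.uIcc ((N + 1 : ℕ) : ℝ) ((N + 1 + 1 : ℕ) : ℝ) := by
      rw [Set.uIcc_of_le hN1]; intro h; exact absurd h.1 (not_le.mpr hN)
    rw [e1, intervalIntegral.integral_sub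
      (intervalIntegral.intervalIntegrable_cpow (Or.inr hnot))
      ((intervalIntegral.intervalIntegrable_cpow (Or.inr hnot)).const_mul _),
      intervalIntegral.integral_const_mul,
      integral_cpow (Or.inr ⟨by intro h; apply h3; linear_combination -h, hnot⟩),
      integral_cpow (Or.inr ⟨by intro h; apply hs0; linear_combination -h, hnot⟩)]
    have p1 : ∀ k : ℕ, (((k + 1 : ℕ) : ℝ) : ℂ) ^ (-s + 1) = ((k + 1 : ℕ) : ℂ) * ((k + 1 : ℕ) : ℂ) ^ (-s) := by
      intro k
      rw [add_comm (-s) 1, cpow_add _ _ (by rw [ofReal_natCast]; exact_mod_cast k.succ_ne_zero), cpow_one,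
        ofReal_natCast]
    have p2 : ∀ k : ℕ, ((k + 1 : ℕ) : ℂ) ^ (1 - s) = ((k + 1 : ℕ) : ℂ) * ((k + 1 : ℕ) : ℂ) ^ (-s) := by
      intro k
      rw [← p1, ofReal_natCast]; congr 1; ring
    rw [p1, p1, p2, p2, show -s - 1 + 1 = -s by ring, ofReal_natCast, ofReal_natCast]
    have h4 : -s + 1 ≠ 0 := by rw [show -s + 1 = -(s - 1) by ring]; exact neg_ne_zero.mpr h3
    generalize ((N + 1 : ℕ) : ℂ) ^ (-s) = a
    generalize ((N + 1 + 1 : ℕ) : ℂ) ^ (-s) = b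
    rw [show -s + 1 = -(s - 1) by ring]
    push_cast
    field_simp
    ring

end ZetaBound

section ZetaUpper
open Complex MeasureTheory Topology Asymptotics

lemma norm_riemannZeta_le {s : ℂ} {Y : ℝ} (hY : 1 ≤ Y) (ht : 1 ≤ |s.im|) (htY : |s.im| ≤ Y ^ 15)
    (h1 : 1 - 1 / 30 ≤ s.re) (h2 : s.re ≤ 4) : ‖riemannZeta s‖ ≤ 42 * Y := by
  have hσ : 0 < s.re := by linarith
  have hs1 : s ≠ 1 := by rintro rfl; simp at ht; linarith
  obtain ⟨Z, hZ, rfl⟩ : ∃ Z : ℝ, 1 ≤ Z ∧ Y = Z ^ 2 :=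
    ⟨√Y, Real.one_le_sqrt.mpr hY, (Real.sq_sqrt (by linarith)).symm⟩
  have hN1 : 1 ≤ ⌊|s.im|⌋₊ := Nat.le_floor (by simpa using ht)
  obtain ⟨N, hN⟩ : ∃ N, ⌊|s.im|⌋₊ = N + 1 := ⟨⌊|s.im|⌋₊ - 1, by omega⟩
  set T : ℝ := ((N + 1 : ℕ) : ℝ) with hT
  have hT1 : 1 ≤ T := by rw [hT]; push_cast; linarith [N.cast_nonneg (α := ℝ)]
  have hT0 : 0 < T := by linarith
  have hTle : T ≤ |s.im| := by rw [hT, ← hN]; exact Nat.floor_le (abs_nonneg _)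
  have hTge : |s.im| ≤ 2 * T := by
    have := Nat.lt_floor_add_one |s.im|
    rw [hN] at this; linarith
  have hTZ : T ≤ Z ^ (30 : ℝ) := by
    have : (Z ^ 2) ^ 15 = Z ^ (30 : ℝ) := by
      rw [← pow_mul, ← Real.rpow_natCast]; norm_num
    rw [← this]; linarith
  have hTη : T ^ (1 / 30 : ℝ) ≤ Z := by
    calc T ^ (1 / 30 : ℝ) ≤ (Z ^ (30 : ℝ)) ^ (1 / 30 : ℝ) :=
          Real.rpow_le_rpow hT0.le hTZ (by norm_num)
      _ = Z := by rw [← Real.rpow_mul (by linarith)]; norm_num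
  have hTσ : T ^ (1 - s.re) ≤ Z :=
    (Real.rpow_le_rpow_of_exponent_le hT1 (by linarith)).trans hTη
  have hlog : Real.log T ≤ 30 * (Z - 1) := by
    calc Real.log T ≤ Real.log (Z ^ (30 : ℝ)) := Real.log_le_log hT0 hTZ
      _ = 30 * Real.log Z := Real.log_rpow (by linarith) _
      _ ≤ _ := by
        have := Real.log_le_sub_one_of_pos (show 0 < Z by linarith)
        linarith
  have hsum : ‖∑ n ∈ Finset.range (N + 1), ((n + 1 : ℕ) : ℂ) ^ (-s)‖ ≤ Z * (1 + Real.log T) := by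
    calc ‖∑ n ∈ Finset.range (N + 1), ((n + 1 : ℕ) : ℂ) ^ (-s)‖
        ≤ ∑ n ∈ Finset.range (N + 1), Z * ((n + 1 : ℕ) : ℝ)⁻¹ := by
          refine norm_sum_le_of_le _ fun n hn => ?_
          have hn0 : (0 : ℝ) < ((n + 1 : ℕ) : ℝ) := by positivity
          have hn1 : (1 : ℝ) ≤ ((n + 1 : ℕ) : ℝ) := by exact_mod_cast Nat.succ_pos n
          have hnT : ((n + 1 : ℕ) : ℝ) ≤ T := by
            rw [hT]; exact_mod_cast Finset.mem_range.mp hn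
          rw [norm_natCast_cpow_of_pos n.succ_pos, neg_re]
          calc ((n + 1 : ℕ) : ℝ) ^ (-s.re) ≤ ((n + 1 : ℕ) : ℝ) ^ (1 / 30 + (-1) : ℝ) :=
                Real.rpow_le_rpow_of_exponent_le hn1 (by linarith)
            _ = ((n + 1 : ℕ) : ℝ) ^ (1 / 30 : ℝ) * ((n + 1 : ℕ) : ℝ)⁻¹ := by
                rw [Real.rpow_add hn0, Real.rpow_neg_one]
            _ ≤ Z * ((n + 1 : ℕ) : ℝ)⁻¹ := by
                gcongr
                exact (Real.rpow_le_rpow hn0.le hnT (by norm_num)).trans hTη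
      _ = Z * ((harmonic (N + 1) : ℚ) : ℝ) := by
          rw [← Finset.mul_sum, harmonic]; push_cast; rfl
      _ ≤ Z * (1 + Real.log T) := by
          gcongr
          exact harmonic_le_one_add_log (N + 1)
  have hmain : ‖((N + 1 : ℕ) : ℂ) ^ (1 - s) / (s - 1)‖ ≤ Z := by
    rw [norm_div, norm_natCast_cpow_of_pos N.succ_pos, sub_re, one_re]
    have : 1 ≤ ‖s - 1‖ := by
      have := abs_im_le_norm (s - 1)
      simp at this; linarith
    exact div_le_of_le_mul₀ (norm_nonneg _) (by linarith) (by nlinarith)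
  have htail : ‖s * ∫ t in Set.Ioi T, ((Int.fract t : ℝ) : ℂ) * (t : ℂ) ^ (-(s + 1))‖ ≤ 11 * Z := by
    have hi : ‖∫ t in Set.Ioi T, ((Int.fract t : ℝ) : ℂ) * (t : ℂ) ^ (-(s + 1))‖
        ≤ ∫ t in Set.Ioi T, t ^ (-s.re - 1) := by
      refine norm_integral_le_of_norm_le
        (integrableOn_Ioi_rpow_of_lt (by linarith) hT0) ?_
      refine (ae_restrict_iff' measurableSet_Ioi).mpr (Eventually.of_forall fun t ht => ?_)
      have ht0 : 0 < t := hT0.trans ht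
      rw [norm_mul, Complex.norm_real, Real.norm_eq_abs, abs_of_nonneg (Int.fract_nonneg _),
        norm_cpow_eq_rpow_re_of_pos ht0]
      refine (mul_le_of_le_one_left (by positivity) (Int.fract_lt_one _).le).trans (le_of_eq ?_)
      congr 1; simp; ring
    rw [integral_Ioi_rpow_of_lt (by linarith) hT0] at hi
    have hns : ‖s‖ ≤ 10 * T := by
      have := norm_le_abs_re_add_abs_im s
      rw [abs_of_pos hσ] at this
      linarith
    rw [norm_mul]
    calc ‖s‖ * _ ≤ (10 * T) * (-T ^ (-s.re - 1 + 1) / (-s.re - 1 + 1)) := by gcongr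
      _ = 10 * T ^ (1 - s.re) / s.re := by
        rw [show -s.re - 1 + 1 = - s.re by ring, neg_div_neg_eq, sub_eq_add_neg,
          Real.rpow_add hT0, Real.rpow_one]; ring
      _ ≤ 11 * Z := by
        rw [div_le_iff₀ hσ]; nlinarith
  rw [riemannZeta_eq_sum_add hσ hs1 N]
  calc _ ≤ Z * (1 + Real.log T) + Z + 11 * Z := by
        refine (norm_sub_le _ _).trans (add_le_add ((norm_add_le _ _).trans (add_le_add hsum hmain)) htail)
    _ ≤ 42 * Z ^ 2 := by nlinarith

end ZetaUpper

section ZetaLower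
open Complex MeasureTheory Topology Asymptotics

lemma norm_deriv_riemannZeta_le {s : ℂ} {Y : ℝ} (hY : 1 ≤ Y) (ht : 2 ≤ |s.im|)
    (htY : |s.im| + 1 ≤ Y ^ 15) (h1 : 1 - 1 / 60 ≤ s.re) (h2 : s.re ≤ 3) :
    ‖deriv riemannZeta s‖ ≤ 2520 * Y := by
  have key : ∀ z : ℂ, ‖z - s‖ ≤ 1 / 60 → z ≠ 1 ∧ ‖riemannZeta z‖ ≤ 42 * Y := by
    intro z hz
    have hre := (abs_le.mp ((abs_re_le_norm (z - s)).trans hz))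
    have him := (abs_im_le_norm (z - s)).trans hz
    rw [sub_re] at hre
    rw [sub_im] at him
    have a1 := abs_sub_abs_le_abs_sub z.im s.im
    have a2 := abs_sub_abs_le_abs_sub s.im z.im
    rw [abs_sub_comm] at a2
    have a3 : 1 ≤ |z.im| := by linarith
    refine ⟨?_, norm_riemannZeta_le hY a3 (by linarith) (by linarith) (by linarith)⟩
    rintro rfl
    simp at a3; linarith
  have := norm_deriv_le_of_forall_mem_sphere_norm_le (f := riemannZeta) (c := s) (R := 1 / 60)
    (C := 42 * Y) (by norm_num) ?_ ?_
  · linarith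
  · refine DifferentiableOn.diffContOnCl fun z hz => ?_
    rw [closure_ball _ (by norm_num)] at hz
    exact (differentiableAt_riemannZeta (key z (by simpa [dist_eq_norm] using hz)).1).differentiableWithinAt
  · intro z hz
    exact (key z (by simpa [dist_eq_norm] using (Metric.mem_sphere.mp hz).le)).2

lemma norm_riemannZeta_one_add_le {x : ℝ} (hx : 0 < x) (hx1 : x ≤ 1) :
    ‖riemannZeta (1 + x)‖ ≤ 3 / x := by
  have h0 : (1 + x : ℂ) ≠ 1 := by simpa using hx.ne'
  have hre : (1 + x : ℂ).re = 1 + x := by simp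
  rw [riemannZeta_eq_inv_sub_add h0, riemannZeta₀_eq (by rw [hre]; linarith)]
  have hn : ‖(1 + x : ℂ)‖ = 1 + x := by
    have : (1 + x : ℂ) = ((1 + x : ℝ) : ℂ) := by push_cast; rfl
    rw [this, Complex.norm_real, Real.norm_of_nonneg (by linarith)]
  have e : ‖((1 + x : ℂ) - 1)⁻¹‖ = 1 / x := by simp [abs_of_pos hx]
  have h3 : 1 ≤ 1 / x := by rw [le_div_iff₀ hx]; linarith
  have hi2 : ‖∫ t in Set.Ioi (1 : ℝ), ((Int.fract t : ℝ) : ℂ) * (t : ℂ) ^ (-((1 + x : ℂ) + 1))‖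
      ≤ 1 / (1 + x) := by
    refine (norm_integral_le_of_norm_le (g := fun t : ℝ => t ^ (-x - 2))
      (integrableOn_Ioi_rpow_of_lt (by linarith) one_pos) ?_).trans ?_
    · refine (ae_restrict_iff' measurableSet_Ioi).mpr (Eventually.of_forall fun t ht => ?_)
      have ht0 : 0 < t := one_pos.trans ht
      rw [norm_mul, Complex.norm_real, Real.norm_eq_abs, abs_of_nonneg (Int.fract_nonneg _),
        norm_cpow_eq_rpow_re_of_pos ht0]
      refine (mul_le_of_le_one_left (by positivity) (Int.fract_lt_one _).le).trans ?_
      refine Real.rpow_le_rpow_of_exponent_le (le_of_lt ht) ?_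
      simp; linarith
    · rw [integral_Ioi_rpow_of_lt (by linarith) one_pos, show -x - 2 + 1 = -(1 + x) by ring,
        neg_div_neg_eq, Real.one_rpow]
  have hm : ‖(1 + x : ℂ) * ∫ t in Set.Ioi (1 : ℝ), ((Int.fract t : ℝ) : ℂ) * (t : ℂ) ^ (-((1 + x : ℂ) + 1))‖
      ≤ 1 := by
    rw [norm_mul, hn]
    calc _ ≤ (1 + x) * (1 / (1 + x)) := by gcongr
      _ = 1 := by field_simp
  have h5 := norm_add_le ((1 + x : ℂ) - 1)⁻¹
    (1 - (1 + x : ℂ) * ∫ t in Set.Ioi (1 : ℝ), ((Int.fract t : ℝ) : ℂ) * (t : ℂ) ^ (-((1 + x : ℂ) + 1)))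
  have h6 := norm_sub_le (1 : ℂ)
    ((1 + x : ℂ) * ∫ t in Set.Ioi (1 : ℝ), ((Int.fract t : ℝ) : ℂ) * (t : ℂ) ^ (-((1 + x : ℂ) + 1)))
  rw [norm_one] at h6
  rw [e] at h5
  have : 3 / x = 3 * (1 / x) := by ring
  linarith

/-- Lower bound to the right of the line `Re s = 1`. -/
lemma norm_riemannZeta_pow_four_ge {x t Y : ℝ} (hY : 1 ≤ Y) (ht : 2 ≤ |t|)
    (htY : 2 * |t| + 1 ≤ Y ^ 15) (hx : 0 < x) (hx1 : x ≤ 1) :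
    x ^ 3 / (1134 * Y) ≤ ‖riemannZeta (1 + x + t * I)‖ ^ 4 := by
  have h := DirichletCharacter.norm_LFunction_product_ge_one (N := 1) 1 hx t
  rw [DirichletCharacter.LFunctionTrivChar, DirichletCharacter.LFunction_modOne_eq,
    DirichletCharacter.LFunction_modOne_eq, norm_mul, norm_mul, norm_pow, norm_pow,
    mul_comm I (t : ℂ)] at h
  have h1 := norm_riemannZeta_one_add_le hx hx1
  have h2 : ‖riemannZeta (1 + x + 2 * I * t)‖ ≤ 42 * Y := by
    have him : (1 + x + 2 * I * t : ℂ).im = 2 * t := by simp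
    have hre : (1 + x + 2 * I * t : ℂ).re = 1 + x := by simp
    have ha : |2 * t| = 2 * |t| := by rw [abs_mul]; simp
    apply norm_riemannZeta_le hY
    · rw [him, ha]; linarith
    · rw [him, ha]; linarith
    · rw [hre]; linarith
    · rw [hre]; linarith
  rw [div_le_iff₀ (by positivity)]
  have h3 : (1 : ℝ) ≤ (3 / x) ^ 3 * ‖riemannZeta (1 + x + t * I)‖ ^ 4 * (42 * Y) := by
    refine h.le.trans ?_
    gcongr
  calc x ^ 3 = x ^ 3 * 1 := by ring
    _ ≤ x ^ 3 * ((3 / x) ^ 3 * ‖riemannZeta (1 + x + t * I)‖ ^ 4 * (42 * Y)) := by gcongr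
    _ = _ := by field_simp; ring

lemma exists_norm_riemannZeta_ge : ∃ κ c : ℝ, 0 < κ ∧ κ ≤ 1 / 60 ∧ 0 < c ∧ ∀ {s : ℂ} {Y : ℝ}, 1 ≤ Y →
    2 ≤ |s.im| → 2 * |s.im| + 1 ≤ Y ^ 15 → 1 - κ / Y ^ 5 ≤ s.re → s.re ≤ 2 →
    c / Y ^ 4 ≤ ‖riemannZeta s‖ := by
  set l : ℝ := 1 / 60480 with hl
  refine ⟨l ^ 4, l ^ 3 / 12, by positivity, by norm_num [hl], by positivity, ?_⟩
  intro s Y hY ht htY h1 h2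
  have hY0 : 0 < Y := by linarith
  have right : ∀ x : ℝ, l ^ 4 / Y ^ 5 ≤ x → x ≤ 1 →
      l ^ 3 / 6 / Y ^ 4 ≤ ‖riemannZeta (1 + x + s.im * I)‖ := by
    intro x hx hx1
    have hx0 : 0 < x := lt_of_lt_of_le (by positivity) hx
    refine le_of_pow_le_pow_left₀ (n := 4) (by norm_num) (norm_nonneg _) ?_
    refine le_trans ?_ (norm_riemannZeta_pow_four_ge hY ht htY hx0 hx1)
    calc (l ^ 3 / 6 / Y ^ 4) ^ 4 = (l ^ 4 / Y ^ 5) ^ 3 / (1296 * Y) := by field_simp; norm_num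
      _ ≤ x ^ 3 / (1134 * Y) := by gcongr; norm_num
  have hs : s = 1 + ((s.re - 1 : ℝ) : ℂ) + s.im * I := by
    apply Complex.ext <;> simp
  rcases le_total (1 + l ^ 4 / Y ^ 5) s.re with h | h
  · have := right (s.re - 1) (by linarith) (by linarith)
    rw [← hs] at this
    refine le_trans ?_ this
    gcongr; norm_num
  · have hY5 : l ^ 4 / Y ^ 5 ≤ 1 / 120 := by
      calc l ^ 4 / Y ^ 5 ≤ l ^ 4 / 1 := by gcongr; exact one_le_pow₀ hY
        _ ≤ 1 / 120 := by norm_num [hl]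
    have h0 := right (l ^ 4 / Y ^ 5) le_rfl (by linarith)
    set z : ℂ := 1 + ((l ^ 4 / Y ^ 5 : ℝ) : ℂ) + s.im * I with hz
    have zre : z.re = 1 + l ^ 4 / Y ^ 5 := by simp only [hz, add_re, ofReal_re, one_re, mul_re, I_re, I_im, ofReal_im]; ring
    have zim : z.im = s.im := by simp only [hz, add_im, ofReal_im, one_im, mul_im, I_re, I_im, ofReal_re]; ring
    have hd : ‖riemannZeta z - riemannZeta s‖ ≤ 2520 * Y * ‖z - s‖ := by
      refine Convex.norm_image_sub_le_of_norm_deriv_le (𝕜 := ℂ) (s := segment ℝ s z) ?_ ?_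
        (convex_segment _ _) (left_mem_segment _ _ _) (right_mem_segment _ _ _)
      all_goals
        rintro w ⟨a, b, ha, hb, hab, rfl⟩
        have wim : (a • s + b • z).im = s.im := by
          simp only [add_im, real_smul, mul_im, ofReal_re, ofReal_im, zim]
          linear_combination s.im * hab
        have wre : (a • s + b • z).re = a * s.re + b * (1 + l ^ 4 / Y ^ 5) := by
          simp only [add_re, real_smul, mul_re, ofReal_re, ofReal_im, zre]; ring
      · refine differentiableAt_riemannZeta ?_
        intro e
        rw [e] at wim
        rw [← wim] at ht
        simp at ht; linarith
      · refine norm_deriv_riemannZeta_le hY (by rwa [wim]) (by rw [wim]; linarith [abs_nonneg s.im]) ?_ ?_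
        · rw [wre]; nlinarith
        · rw [wre]; nlinarith
    have hzs : ‖z - s‖ ≤ 2 * (l ^ 4 / Y ^ 5) := by
      have : z - s = ((1 + l ^ 4 / Y ^ 5 - s.re : ℝ) : ℂ) := by
        apply Complex.ext
        · simp [-ofReal_add, zre]
        · simp [-ofReal_add, zim]
      rw [this, Complex.norm_real, Real.norm_of_nonneg (by linarith)]
      linarith
    have h5 : ‖riemannZeta z‖ - ‖riemannZeta s‖ ≤ ‖riemannZeta z - riemannZeta s‖ := norm_sub_norm_le _ _
    have h6 : 2520 * Y * ‖z - s‖ ≤ l ^ 3 / 12 / Y ^ 4 := by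
      calc 2520 * Y * ‖z - s‖ ≤ 2520 * Y * (2 * (l ^ 4 / Y ^ 5)) := by gcongr
        _ = l ^ 3 / 12 / Y ^ 4 * (60480 * l) := by field_simp; norm_num
        _ = l ^ 3 / 12 / Y ^ 4 := by rw [hl]; norm_num
    have h7 : l ^ 3 / 6 / Y ^ 4 = l ^ 3 / 12 / Y ^ 4 + l ^ 3 / 12 / Y ^ 4 := by ring
    linarith

end ZetaLower

section LogDeriv
open Complex MeasureTheory Topology Asymptotics

/-- Minus the logarithmic derivative of `ζ`, minus `ζ`, divided by `s`, with the removable singularity at `1` removed. -/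
noncomputable def zetaRemainder (s : ℂ) : ℂ :=
  (-deriv riemannZeta₁ s / riemannZeta₁ s - riemannZeta₀ s) / s

lemma riemannZeta₁_eq_sub_one_mul {s : ℂ} (hs : s ≠ 1) :
    riemannZeta₁ s = (s - 1) * riemannZeta s := by
  have : s - 1 ≠ 0 := sub_ne_zero.mpr hs
  rw [riemannZeta_eq_inv_sub_mul hs]; field_simp

lemma riemannZeta₁_ne_zero {s : ℂ} (hs : 1 ≤ s.re) : riemannZeta₁ s ≠ 0 := by
  by_cases h : s = 1
  · rw [h, riemannZeta₁_one]; exact one_ne_zero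
  · rw [riemannZeta₁_eq_sub_one_mul h]
    exact mul_ne_zero (sub_ne_zero.mpr h) (riemannZeta_ne_zero_of_one_le_re hs)

lemma zetaRemainder_eq {s : ℂ} (hs : s ≠ 1) (h0 : riemannZeta s ≠ 0) :
    zetaRemainder s = (-deriv riemannZeta s / riemannZeta s - riemannZeta s) / s := by
  have h1 : s - 1 ≠ 0 := sub_ne_zero.mpr hs
  have hd : deriv riemannZeta₁ s = riemannZeta s + (s - 1) * deriv riemannZeta s := by
    have he : riemannZeta₁ =ᶠ[𝓝 s] fun z => (z - 1) * riemannZeta z := by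
      filter_upwards [isOpen_ne.mem_nhds hs] with z hz using riemannZeta₁_eq_sub_one_mul hz
    rw [he.deriv_eq]
    have : HasDerivAt (fun z => (z - 1) * riemannZeta z)
        (1 * riemannZeta s + (s - 1) * deriv riemannZeta s) s :=
      ((hasDerivAt_id s).sub_const 1).mul (differentiableAt_riemannZeta hs).hasDerivAt
    rw [this.deriv, one_mul]
  rw [zetaRemainder, hd, riemannZeta₁_eq_sub_one_mul hs]
  have h2 := riemannZeta_eq_inv_sub_add hs
  have h3 : riemannZeta₀ s = riemannZeta s - (s - 1)⁻¹ := by rw [h2]; ring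
  rw [h3]
  congr 1
  field_simp
  ring

lemma analyticAt_zetaRemainder {s : ℂ} (hs : 1 ≤ s.re) : AnalyticAt ℂ zetaRemainder s := by
  have h0 : s ≠ 0 := by rintro rfl; simp at hs; linarith
  have h1 : AnalyticAt ℂ riemannZeta₁ s := differentiable_riemannZeta₁.analyticAt s
  exact ((h1.deriv.neg.div h1 (riemannZeta₁_ne_zero hs)).sub
    (differentiable_riemannZeta₀.analyticAt s)).div analyticAt_id h0

lemma exists_norm_iteratedDeriv_zetaRemainder_le :
    ∃ C : ℝ, ∀ s : ℂ, 1 < s.re → s.re ≤ 3 / 2 → ‖iteratedDeriv 2 zetaRemainder s‖ ≤ C := by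
  obtain ⟨κ, c, hκ, hκ1, hc, hlow⟩ := exists_norm_riemannZeta_ge
  obtain ⟨C1, hC1⟩ : ∃ C1 : ℝ, ∀ s ∈ Set.Icc (1 : ℝ) (3 / 2) ×ℂ Set.Icc (-3 : ℝ) 3,
      ‖iteratedDeriv 2 zetaRemainder s‖ ≤ C1 := by
    refine IsCompact.exists_bound_of_continuousOn (isCompact_Icc.reProdIm isCompact_Icc) ?_
    intro s hs
    have ha := (analyticAt_zetaRemainder hs.1.1).iterated_deriv 2
    rw [← iteratedDeriv_eq_iterate] at ha
    exact ha.continuousAt.continuousWithinAt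
  have hfar : ∀ s : ℂ, 1 < s.re → s.re ≤ 3 / 2 → 3 ≤ |s.im| →
      ‖iteratedDeriv 2 zetaRemainder s‖ ≤ 64 * (2520 / c + 42) / κ ^ 2 := by
    intro s h1 h2 ht
    obtain ⟨Y, hY, hY15⟩ : ∃ Y : ℝ, 1 ≤ Y ∧ Y ^ 15 = 4 * |s.im| := by
      refine ⟨(4 * |s.im|) ^ (1 / 15 : ℝ), Real.one_le_rpow (by linarith) (by norm_num), ?_⟩
      rw [← Real.rpow_natCast, ← Real.rpow_mul (by linarith)]; norm_num
    have hY0 : 0 < Y := by linarith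
    set r : ℝ := κ / (2 * Y ^ 5) with hr
    have hr0 : 0 < r := by positivity
    have hr1 : r ≤ 1 / 120 := by
      calc r ≤ (1 / 60) / (2 * 1) := by rw [hr]; gcongr; exact one_le_pow₀ hY
        _ = 1 / 120 := by norm_num
    have hrκ : r ≤ κ / Y ^ 5 := by rw [hr]; gcongr; linarith [pow_pos hY0 5]
    have key : ∀ z : ℂ, ‖z - s‖ ≤ r → z ≠ 1 ∧ z ≠ 0 ∧ riemannZeta z ≠ 0 ∧ ‖zetaRemainder z‖ ≤
        (2520 / c + 42) * Y ^ 5 * (2 / |s.im|) := by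
      intro z hz
      have hre := (abs_le.mp ((abs_re_le_norm (z - s)).trans hz))
      have him := (abs_im_le_norm (z - s)).trans hz
      rw [sub_re] at hre
      rw [sub_im] at him
      have a1 := abs_sub_abs_le_abs_sub z.im s.im
      have a2 := abs_sub_abs_le_abs_sub s.im z.im
      rw [abs_sub_comm] at a2
      have a3 : 2 ≤ |z.im| := by linarith
      have hz1 : z ≠ 1 := by rintro rfl; simp at a3; linarith
      have hz0 : z ≠ 0 := by rintro rfl; simp at a3; linarith
      have l1 := hlow hY a3 (by linarith) (by linarith) (by linarith)
      have l0 : 0 < ‖riemannZeta z‖ := lt_of_lt_of_le (by positivity) l1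
      have l2 := norm_deriv_riemannZeta_le hY a3 (by linarith) (by linarith) (by linarith)
      have l3 := norm_riemannZeta_le hY (by linarith : 1 ≤ |z.im|) (by linarith) (by linarith) (by linarith)
      have hne : riemannZeta z ≠ 0 := norm_pos_iff.mp l0
      refine ⟨hz1, hz0, hne, ?_⟩
      rw [zetaRemainder_eq hz1 hne, norm_div, div_eq_mul_one_div]
      have hzn : |s.im| / 2 ≤ ‖z‖ := by
        have := abs_im_le_norm z; linarith
      have hinv : 1 / ‖z‖ ≤ 2 / |s.im| := by
        rw [div_le_div_iff₀ (by linarith) (by linarith)]; linarith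
      refine mul_le_mul ?_ hinv (by positivity) (by positivity)
      calc ‖-deriv riemannZeta z / riemannZeta z - riemannZeta z‖
          ≤ ‖deriv riemannZeta z‖ / ‖riemannZeta z‖ + ‖riemannZeta z‖ := by
            refine (norm_sub_le _ _).trans ?_
            rw [norm_div, norm_neg]
        _ ≤ 2520 * Y / (c / Y ^ 4) + 42 * Y ^ 5 := by
            gcongr
            exact l3.trans (by gcongr; exact le_self_pow₀ hY (by norm_num))
        _ = _ := by field_simp
    have := norm_iteratedDeriv_le_of_forall_mem_sphere_norm_le (n := 2) (f := zetaRemainder) (c := s)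
      (C := (2520 / c + 42) * Y ^ 5 * (2 / |s.im|)) (R := r) hr0 ?_ ?_
    · refine this.trans (le_of_eq ?_)
      have e1 : |s.im| = Y ^ 15 / 4 := by rw [hY15]; ring
      rw [e1, hr]
      simp only [Nat.factorial]
      push_cast
      field_simp
      norm_num
    · refine DifferentiableOn.diffContOnCl fun z hz => ?_
      rw [closure_ball _ hr0.ne'] at hz
      obtain ⟨hz1, hz0, hne, -⟩ := key z (by simpa [dist_eq_norm] using hz)
      refine DifferentiableAt.differentiableWithinAt ?_
      have hn1 : riemannZeta₁ z ≠ 0 := by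
        rw [riemannZeta₁_eq_sub_one_mul hz1]; exact mul_ne_zero (sub_ne_zero.mpr hz1) hne
      have h1 : AnalyticAt ℂ riemannZeta₁ z := differentiable_riemannZeta₁.analyticAt z
      exact (((h1.deriv.neg.div h1 hn1).sub
        (differentiable_riemannZeta₀.analyticAt z)).div analyticAt_id hz0).differentiableAt
    · intro z hz
      exact (key z (by simpa [dist_eq_norm] using (Metric.mem_sphere.mp hz).le)).2.2.2
  refine ⟨max C1 (64 * (2520 / c + 42) / κ ^ 2), fun s h1 h2 => ?_⟩
  rcases le_total 3 |s.im| with h | h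
  · exact (hfar s h1 h2 h).trans (le_max_right _ _)
  · exact (hC1 s ⟨⟨h1.le, h2⟩, abs_le.mp h⟩).trans (le_max_left _ _)

end LogDeriv

section PsiMellin
open Complex MeasureTheory Topology Asymptotics

/-- The difference between Chebyshev's function and the floor function. -/
noncomputable def psiErr (t : ℝ) : ℝ := Chebyshev.psi t - (⌊t⌋₊ : ℝ)

lemma psiErr_eq_zero {t : ℝ} (ht : t < 1) : psiErr t = 0 := by
  rw [psiErr, Chebyshev.psi_eq_zero_of_le_one ht.le, Nat.floor_eq_zero.mpr ht]; simp

lemma abs_psiErr_le {t : ℝ} (ht : 0 ≤ t) : |psiErr t| ≤ 6 * t := by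
  have h1 := Chebyshev.psi_nonneg t
  have h2 := Chebyshev.psi_le_const_mul_self ht
  have h3 := Nat.floor_le ht
  have h4 : (0 : ℝ) ≤ (⌊t⌋₊ : ℝ) := Nat.cast_nonneg _
  have h5 : Real.log 4 ≤ 2 := by
    have : (4 : ℝ) = 2 ^ 2 := by norm_num
    rw [this, Real.log_pow]; have := Real.log_two_lt_d9; push_cast; linarith
  have h6 : (Real.log 4 + 4) * t ≤ 6 * t := by gcongr; linarith
  rw [psiErr, abs_le]; constructor <;> linarith

lemma measurable_psiErr : Measurable psiErr := by
  refine Chebyshev.psi_mono.measurable.sub ?_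
  exact (Nat.mono_cast.comp Nat.floor_mono : Monotone fun t : ℝ => ((⌊t⌋₊ : ℕ) : ℝ)).measurable

lemma locallyIntegrableOn_psiErr :
    LocallyIntegrableOn (fun t : ℝ => (psiErr t : ℂ)) (Set.Ioi 0) := by
  have h : LocallyIntegrableOn (fun t : ℝ => 6 * t) (Set.Ioi 0) :=
    (by fun_prop : Continuous fun t : ℝ => 6 * t).locallyIntegrable.locallyIntegrableOn _
  intro x hx
  obtain ⟨u, hu, hi⟩ := h x hx
  refine ⟨u ∩ Set.Ioi 0, inter_mem hu self_mem_nhdsWithin, ?_⟩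
  refine (hi.mono_set Set.inter_subset_left).mono'
    (by have := measurable_psiErr; fun_prop) ?_
  have hm : MeasurableSet (Set.Ioi (0 : ℝ)) := measurableSet_Ioi
  have : volume.restrict (u ∩ Set.Ioi 0) ≤ volume.restrict (Set.Ioi (0 : ℝ)) :=
    Measure.restrict_mono_set _ Set.inter_subset_right
  refine this.absolutelyContinuous.ae_le ?_
  refine (ae_restrict_iff' hm).mpr (Eventually.of_forall fun t ht => ?_)
  rw [Complex.norm_real]; exact abs_psiErr_le (le_of_lt ht)

lemma psiErr_isBigO_top : (fun t : ℝ => (psiErr t : ℂ)) =O[atTop] (fun t : ℝ => t ^ (-(-1 : ℝ))) := by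
  refine IsBigO.of_bound 6 ?_
  filter_upwards [eventually_ge_atTop 0] with t ht
  rw [Complex.norm_real, neg_neg, Real.rpow_one, Real.norm_of_nonneg ht]
  exact abs_psiErr_le ht

lemma psiErr_isBigO_zero (b : ℝ) :
    (fun t : ℝ => (psiErr t : ℂ)) =O[𝓝[>] 0] (fun t : ℝ => t ^ (-b)) := by
  refine IsBigO.of_bound 1 ?_
  have : ∀ᶠ t : ℝ in 𝓝[>] 0, t < 1 := nhdsWithin_le_nhds (eventually_lt_nhds one_pos)
  filter_upwards [this] with t ht
  rw [psiErr_eq_zero ht]; simp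

lemma zetaRemainder_eq_mellin {s : ℂ} (hs : 1 < s.re) :
    zetaRemainder s = mellin (fun t : ℝ => (psiErr t : ℂ)) (-s) := by
  have hs1 : s ≠ 1 := by rintro rfl; simp at hs
  have hs0 : s ≠ 0 := by rintro rfl; simp at hs; linarith
  rw [zetaRemainder_eq hs1 (riemannZeta_ne_zero_of_one_lt_re hs),
    ← ArithmeticFunction.LSeries_vonMangoldt_eq_deriv_riemannZeta_div hs,
    ← LSeries_one_eq_riemannZeta hs]
  have h1 := ArithmeticFunction.LSeriesSummable_vonMangoldt hs
  have h2 : LSeriesSummable 1 s := LSeriesSummable_one_iff.mpr hs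
  have hsum : ∀ n : ℕ, ∑ k ∈ Icc 1 n, ((fun n => (ArithmeticFunction.vonMangoldt n : ℂ)) - 1) k =
      ((Chebyshev.psi n - n : ℝ) : ℂ) := by
    intro n
    simp only [Pi.sub_apply, Pi.one_apply, Chebyshev.psi, Nat.floor_natCast]
    rw [Finset.sum_sub_distrib]
    simp
    rfl
  rw [← LSeries_sub h1 h2, LSeries_eq_mul_integral _ zero_le_one hs (h1.sub h2), mul_div_cancel_left₀ _ hs0]
  · rw [mellin]
    have : ∀ t : ℝ, (t : ℂ) ^ (-s - 1) • ((psiErr t : ℝ) : ℂ) =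
        (Set.Ici (1 : ℝ)).indicator
          (fun t => ((psiErr t : ℝ) : ℂ) * (t : ℂ) ^ (-(s + 1))) t := by
      intro t
      by_cases h : t ∈ Set.Ici (1 : ℝ)
      · rw [Set.indicator_of_mem h, smul_eq_mul, mul_comm]
        congr 2; ring
      · rw [Set.indicator_of_notMem h, psiErr_eq_zero (by simpa using h)]; simp
    simp_rw [this]
    rw [setIntegral_indicator measurableSet_Ici, Set.inter_eq_right.mpr
      (show Set.Ici (1 : ℝ) ⊆ Set.Ioi 0 from fun t ht =>
        lt_of_lt_of_le (one_pos (α := ℝ)) ht),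
      integral_Ici_eq_integral_Ioi]
    refine setIntegral_congr_fun measurableSet_Ioi fun t ht => ?_
    simp only [hsum]
    rw [psiErr, Chebyshev.psi_eq_psi_coe_floor t]
  · refine IsBigO.of_bound 6 ?_
    filter_upwards with n
    have := abs_psiErr_le (Nat.cast_nonneg (α := ℝ) n)
    rw [psiErr, Nat.floor_natCast] at this
    rw [hsum, Complex.norm_real, Real.rpow_one, Real.norm_natCast]
    exact this

lemma mellin_iteratedDeriv_psiErr {w : ℂ} (hw : w.re < -1) :
    deriv (deriv (mellin (fun t : ℝ => (psiErr t : ℂ)))) w =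
      mellin (fun t => Real.log t • Real.log t • (psiErr t : ℂ)) w := by
  have h1 : ∀ z : ℂ, z.re < -1 → HasDerivAt (mellin (fun t : ℝ => (psiErr t : ℂ)))
      (mellin (fun t => Real.log t • (psiErr t : ℂ)) z) z := fun z hz =>
    (mellin_hasDerivAt_of_isBigO_rpow locallyIntegrableOn_psiErr psiErr_isBigO_top hz
      (psiErr_isBigO_zero (z.re - 1)) (by linarith)).2
  have h2 : HasDerivAt (mellin (fun t : ℝ => Real.log t • (psiErr t : ℂ)))
      (mellin (fun t => Real.log t • Real.log t • (psiErr t : ℂ)) w) w := by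
    refine (mellin_hasDerivAt_of_isBigO_rpow (a := (w.re - 1) / 2) (b := w.re - 1) ?_ ?_ (by linarith) ?_ (by linarith)).2
    · refine locallyIntegrableOn_psiErr.continuousOn_smul isOpen_Ioi.isLocallyClosed ?_
      exact Real.continuousOn_log.mono fun t ht => ne_of_gt ht
    · exact isBigO_rpow_top_log_smul (by linarith) psiErr_isBigO_top
    · exact isBigO_rpow_zero_log_smul (by linarith) (psiErr_isBigO_zero (w.re - 2))
  have he : deriv (mellin (fun t : ℝ => (psiErr t : ℂ))) =ᶠ[𝓝 w]
      mellin (fun t => Real.log t • (psiErr t : ℂ)) := by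
    filter_upwards [(isOpen_lt continuous_re continuous_const).mem_nhds hw] with z hz
    exact (h1 z hz).deriv
  rw [he.deriv_eq, h2.deriv]

/-- The Fourier transforms of `u ↦ u² (ψ(e⁻ᵘ) - ⌊e⁻ᵘ⌋) e^{σu}` are bounded uniformly as `σ → 1⁺`. -/
lemma exists_norm_fourier_psiErr_le : ∃ C : ℝ, ∀ σ : ℝ, 1 < σ → σ ≤ 3 / 2 → ∀ ξ : ℝ,
    ‖FourierTransform.fourier
      (fun u : ℝ => ((Real.exp (σ * u) * (u ^ 2 * psiErr (Real.exp (-u))) : ℝ) : ℂ)) ξ‖ ≤ C := by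
  obtain ⟨C, hC⟩ := exists_norm_iteratedDeriv_zetaRemainder_le
  refine ⟨C, fun σ h1 h2 ξ => ?_⟩
  set w : ℂ := -σ + (2 * Real.pi * ξ : ℝ) * I with hw
  have wre : w.re = -σ := by simp [hw]
  have wim : w.im = 2 * Real.pi * ξ := by simp [hw]
  have h := hC (-w) (by simp [wre, h1]) (by simpa [wre] using h2)
  have he : zetaRemainder =ᶠ[𝓝 (-w)] fun s => mellin (fun t : ℝ => (psiErr t : ℂ)) (-s) := by
    have : ∀ᶠ z : ℂ in 𝓝 (-w), 1 < z.re :=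
      (isOpen_lt continuous_const continuous_re).mem_nhds (by simp [wre, h1])
    filter_upwards [this] with z hz using zetaRemainder_eq_mellin hz
  rw [he.iteratedDeriv_eq 2, iteratedDeriv_comp_neg, neg_neg, iteratedDeriv_succ, iteratedDeriv_one,
    mellin_iteratedDeriv_psiErr (by rw [wre]; linarith), mellin_eq_fourier, wre, wim] at h
  have e : 2 * Real.pi * ξ / (2 * Real.pi) = ξ := by field_simp
  rw [e] at h
  norm_num at h
  convert h using 4
  push_cast
  ring

end PsiMellin

section Tauberian
open Complex MeasureTheory Topology Asymptotics

/-- A function with bounded Fourier transform cannot be large on a whole interval. -/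
lemma exists_mul_length_le_of_fourier_le : ∃ M : ℝ, ∀ (F : ℝ → ℝ) (C : ℝ), Integrable F →
    (∀ ξ, ‖FourierTransform.fourier (fun y => (F y : ℂ)) ξ‖ ≤ C) → ∀ a h m : ℝ, 0 < h →
    (∀ y ∈ Set.Icc a (a + h), m ≤ F y) → m * h ≤ M * C := by
  let φ : ContDiffBump (1 / 2 : ℝ) := ⟨1 / 4, 1 / 2, by norm_num, by norm_num⟩
  have hφi : 0 < ∫ x, φ x := φ.integral_pos
  have hsupp : ∀ x, x ∉ Set.Icc (0 : ℝ) 1 → φ x = 0 := by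
    intro x hx
    refine φ.zero_of_le_dist ?_
    show (1 / 2 : ℝ) ≤ _
    rw [Real.dist_eq]
    by_contra hlt
    push Not at hlt
    rw [abs_lt] at hlt
    exact hx ⟨by linarith [hlt.1], by linarith [hlt.2]⟩
  have hcs : HasCompactSupport (fun x => ((φ x : ℝ) : ℂ)) :=
    φ.hasCompactSupport.comp_left (g := fun x : ℝ => (x : ℂ)) (by simp)
  let Φ : SchwartzMap ℝ ℂ := hcs.toSchwartzMap (Complex.ofRealCLM.contDiff.comp φ.contDiff)
  let G : SchwartzMap ℝ ℂ := FourierTransformInv.fourierInv Φ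
  have hG : ∀ y, FourierTransform.fourier (G : ℝ → ℂ) y = (φ y : ℂ) := by
    intro y
    rw [← SchwartzMap.fourier_coe, FourierTransform.fourier_fourierInv_eq]
    rfl
  refine ⟨(∫ ξ, ‖G ξ‖) / ∫ x, φ x, fun F C hF hC a h m hh hm => ?_⟩
  have hC0 : 0 ≤ C := (norm_nonneg _).trans (hC 0)
  let g : ℝ → ℂ := fun ξ => h * (cexp ((2 * Real.pi * a * ξ : ℝ) * I) * G (h * ξ))
  have hgn : ∀ ξ, ‖g ξ‖ = h * ‖G (h * ξ)‖ := by
    intro ξ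
    simp only [g]
    rw [norm_mul, norm_mul, norm_exp_ofReal_mul_I, Complex.norm_real, Real.norm_of_nonneg hh.le, one_mul]
  have hGi : Integrable (fun ξ => G (h * ξ)) := G.integrable.comp_mul_left' hh.ne'
  have hgi : Integrable g := by
    refine (hGi.norm.const_mul h).mono' ?_ (Eventually.of_forall fun ξ => (hgn ξ).le)
    have : Continuous G := G.continuous
    exact (by fun_prop : Continuous g).aestronglyMeasurable
  have hgint : ∫ ξ, ‖g ξ‖ = ∫ ξ, ‖G ξ‖ := by
    simp_rw [hgn]
    rw [integral_const_mul, Measure.integral_comp_mul_left (fun ξ => ‖G ξ‖), abs_of_pos (inv_pos.mpr hh), smul_eq_mul]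
    field_simp
  have hgF : ∀ y, FourierTransform.fourier g y = (φ ((y - a) / h) : ℂ) := by
    intro y
    rw [← hG, Real.fourier_real_eq_integral_exp_smul, Real.fourier_real_eq_integral_exp_smul]
    have := Measure.integral_comp_mul_left
      (fun v => cexp (((-2 * Real.pi * v * ((y - a) / h) : ℝ) : ℂ) * I) • G v) h
    rw [abs_of_pos (inv_pos.mpr hh)] at this
    have h2 : ∫ v, cexp (((-2 * Real.pi * v * ((y - a) / h) : ℝ) : ℂ) * I) • G v =
        h • ∫ x, cexp (((-2 * Real.pi * (h * x) * ((y - a) / h) : ℝ) : ℂ) * I) • G (h * x) := by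
      rw [this, smul_smul, mul_inv_cancel₀ hh.ne', one_smul]
    rw [h2, ← integral_smul]
    congr 1
    ext v
    simp only [g, smul_eq_mul, real_smul]
    have e : cexp (((-2 * Real.pi * (h * v) * ((y - a) / h) : ℝ) : ℂ) * I) =
        cexp (((-2 * Real.pi * v * y : ℝ) : ℂ) * I) * cexp ((2 * Real.pi * a * v : ℝ) * I) := by
      rw [← Complex.exp_add]
      congr 1
      have : (-2 * Real.pi * (h * v) * ((y - a) / h) : ℝ) = -2 * Real.pi * v * y + 2 * Real.pi * a * v := by
        field_simp; ring
      rw [this]; push_cast; ring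
    rw [e]; ring
  have hpair : ∫ ξ, FourierTransform.fourier (fun y => (F y : ℂ)) ξ * g ξ =
      ∫ y, (F y : ℂ) * (φ ((y - a) / h) : ℂ) := by
    have := VectorFourier.integral_fourierIntegral_smul_eq_flip (L := innerₗ ℝ) (f := fun y => (F y : ℂ)) (g := g)
      Real.continuous_fourierChar continuous_inner hF.ofReal hgi
    simp_rw [← hgF]
    rw [flip_innerₗ] at this
    exact this
  have hup : ‖∫ y, (F y : ℂ) * (φ ((y - a) / h) : ℂ)‖ ≤ C * ∫ ξ, ‖G ξ‖ := by
    rw [← hpair, ← hgint, ← integral_const_mul]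
    refine norm_integral_le_of_norm_le (hgi.norm.const_mul C) (Eventually.of_forall fun ξ => ?_)
    rw [norm_mul]
    exact mul_le_mul_of_nonneg_right (hC ξ) (norm_nonneg _)
  have hφint : ∫ y, φ ((y - a) / h) = h * ∫ x, φ x := by
    have h1 := integral_sub_right_eq_self (μ := volume) (fun y => φ (y / h)) a
    have h2 := Measure.integral_comp_div (fun y => φ y) h
    rw [h1, h2, abs_of_pos hh, smul_eq_mul]
  have hφI : Integrable (fun y => φ ((y - a) / h)) := by
    have := (φ.integrable (μ := volume)).comp_div hh.ne'
    exact this.comp_sub_right a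
  have hlow : m * (h * ∫ x, φ x) ≤ ∫ y, F y * φ ((y - a) / h) := by
    rw [← hφint, ← integral_const_mul]
    refine integral_mono (hφI.const_mul m) ?_ fun y => ?_
    · refine Integrable.mul_bdd (c := 1) hF hφI.aestronglyMeasurable (Eventually.of_forall fun y => ?_)
      rw [Real.norm_of_nonneg φ.nonneg]; exact φ.le_one
    · by_cases hy : y ∈ Set.Icc a (a + h)
      · exact mul_le_mul_of_nonneg_right (hm y hy) φ.nonneg
      · have : φ ((y - a) / h) = 0 := by
          refine hsupp _ fun hc => hy ⟨?_, ?_⟩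
          · have := hc.1; rw [le_div_iff₀ hh] at this; linarith
          · have := hc.2; rw [div_le_iff₀ hh] at this; linarith
        simp [this]
  have hreal : ∫ y, F y * φ ((y - a) / h) ≤ C * ∫ ξ, ‖G ξ‖ := by
    refine (le_abs_self _).trans ?_
    rw [← Real.norm_eq_abs, ← Complex.norm_real, ← integral_complex_ofReal]
    simpa using hup
  rw [div_mul_eq_mul_div, le_div_iff₀ hφi]
  linarith

end Tauberian

section PrimeNumberTheorem
open Complex MeasureTheory Topology Asymptotics

lemma integrable_exp_mul_psiErr {σ : ℝ} (hσ : 1 < σ) :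
    Integrable (fun u : ℝ => Real.exp (σ * u) * (u ^ 2 * psiErr (Real.exp (-u)))) := by
  set ε : ℝ := (σ - 1) / 2 with hε
  have hε0 : 0 < ε := by rw [hε]; linarith
  have h1 : Integrable ((Set.Iic (0 : ℝ)).indicator fun u => (12 / ε ^ 2) * Real.exp (ε * u)) :=
    (integrable_indicator_iff measurableSet_Iic).mpr ((integrableOn_exp_mul_Iic hε0 0).const_mul _)
  refine h1.mono' ?_ (Eventually.of_forall fun u => ?_)
  · have := measurable_psiErr
    exact (by fun_prop : Measurable (fun u : ℝ => Real.exp (σ * u) * (u ^ 2 * psiErr (Real.exp (-u))))).aestronglyMeasurable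
  · by_cases hu : u ∈ Set.Iic (0 : ℝ)
    · rw [Set.indicator_of_mem hu, Real.norm_eq_abs, abs_mul, abs_mul, abs_of_pos (Real.exp_pos _),
        abs_of_nonneg (sq_nonneg u)]
      have h2 := abs_psiErr_le (Real.exp_pos (-u)).le
      have hu0 : u ≤ 0 := hu
      have h3 := Real.quadratic_le_exp_of_nonneg (show 0 ≤ ε * (-u) by nlinarith)
      have h4 : u ^ 2 ≤ 2 / ε ^ 2 * Real.exp (ε * (-u)) := by
        rw [div_mul_eq_mul_div, le_div_iff₀ (by positivity)]
        nlinarith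
      calc Real.exp (σ * u) * (u ^ 2 * |psiErr (Real.exp (-u))|)
          ≤ Real.exp (σ * u) * ((2 / ε ^ 2 * Real.exp (ε * (-u))) * (6 * Real.exp (-u))) := by gcongr
        _ = 12 / ε ^ 2 * (Real.exp (σ * u) * Real.exp (ε * (-u)) * Real.exp (-u)) := by ring
        _ = 12 / ε ^ 2 * Real.exp (ε * u) := by
            rw [← Real.exp_add, ← Real.exp_add]; congr 2; rw [hε]; ring
    · rw [Set.indicator_of_notMem hu, psiErr_eq_zero]
      · simp
      · rw [Real.exp_lt_one_iff]; simpa using hu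

/-- The prime number theorem for Chebyshev's `ψ`, with a logarithmic saving. -/
lemma exists_abs_psiErr_mul_log_le : ∃ C : ℝ, ∀ x : ℝ, Real.exp 2 ≤ x → |psiErr x| * Real.log x ≤ C * x := by
  obtain ⟨M, hM⟩ := exists_mul_length_le_of_fourier_le
  obtain ⟨C0, hC0⟩ := exists_norm_fourier_psiErr_le
  set c1 : ℝ := Real.exp (-5 / 2) / 8 with hc1
  have hc1p : 0 < c1 := by positivity
  refine ⟨max 4 √(16 * (M * C0) / c1), fun x hx => ?_⟩
  have hx0 : 0 < x := lt_of_lt_of_le (Real.exp_pos _) hx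
  set V : ℝ := Real.log x with hV
  have hV2 : 2 ≤ V := by rw [hV, Real.le_log_iff_exp_le hx0]; exact hx
  have hxV : Real.exp V = x := Real.exp_log hx0
  set δ : ℝ := |psiErr x| / x with hδ
  have hδ6 : δ ≤ 6 := by rw [hδ, div_le_iff₀ hx0]; exact abs_psiErr_le hx0.le
  have hδ0 : 0 ≤ δ := by positivity
  have hδx : |psiErr x| = δ * x := by rw [hδ]; field_simp
  suffices hs : δ * V ≤ max 4 √(16 * (M * C0) / c1) by
    rw [hδx]; nlinarith
  rcases lt_or_ge (δ * x) 4 with hsmall | hbig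
  · refine le_trans ?_ (le_max_left _ _)
    have : V ≤ x := by rw [hV]; exact Real.log_le_self hx0.le
    nlinarith
  refine le_trans ?_ (le_max_right _ _)
  have hδp : 0 < δ := by
    rcases hδ0.lt_or_eq with h | h
    · exact h
    · rw [← h] at hbig; norm_num at hbig
  set σ : ℝ := 1 + 1 / V with hσ
  have hVp : 0 < V := by linarith
  have hV' : 1 / V ≤ 1 / 2 := by rw [div_le_div_iff₀ hVp two_pos]; linarith
  have hσ1 : 1 < σ := by rw [hσ]; have : 0 < 1 / V := by positivity
                         linarith
  have hσ2 : σ ≤ 3 / 2 := by rw [hσ]; linarith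
  have hσV : σ * V = V + 1 := by rw [hσ]; field_simp
  have hfl1 := Nat.floor_le hx0.le
  have hfl2 := Nat.lt_floor_add_one x
  set h : ℝ := δ / 16 with hh
  have hhp : 0 < h := by positivity
  have hh1 : h ≤ 3 / 8 := by rw [hh]; linarith
  apply Real.le_sqrt_of_sq_le
  rw [le_div_iff₀ hc1p]
  suffices hmain : c1 * (V ^ 2 * δ) * h ≤ M * C0 by rw [hh] at hmain; linarith
  have hE25 : Real.exp (-5 / 2) = 8 * c1 := by rw [hc1]; ring
  rcases le_total 0 (psiErr x) with hpos | hneg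
  · rw [abs_of_nonneg hpos] at hδx
    refine hM _ C0 (integrable_exp_mul_psiErr hσ1) (hC0 σ hσ1 hσ2) (-V - h) h _ hhp fun u hu => ?_
    have hu1 : V ≤ -u := by linarith [hu.2]
    have hu2 : -u ≤ V + h := by linarith [hu.1]
    have hexp : Real.exp (-u) ≤ x * (1 + 2 * h) := by
      calc Real.exp (-u) ≤ Real.exp (V + h) := Real.exp_le_exp.mpr hu2
        _ = x * Real.exp h := by rw [Real.exp_add, hxV]
        _ ≤ x * (1 + 2 * h) := by
          gcongr
          have := Real.exp_bound_div_one_sub_of_interval hhp.le (by linarith : h < 1)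
          refine this.trans ?_
          rw [div_le_iff₀ (by linarith)]; nlinarith
    have hE : δ * x / 2 ≤ psiErr (Real.exp (-u)) := by
      have h1 : Chebyshev.psi x ≤ Chebyshev.psi (Real.exp (-u)) := by
        apply Chebyshev.psi_mono; rw [← hxV]; exact Real.exp_le_exp.mpr hu1
      have h2 := Nat.floor_le (Real.exp_pos (-u)).le
      rw [psiErr] at hδx ⊢
      have h3 : x * h = δ * x / 16 := by rw [hh]; ring
      nlinarith
    have hx3 : Real.exp (-5 / 2) / x ≤ Real.exp (σ * u) := by
      rw [div_le_iff₀ hx0, ← hxV, ← Real.exp_add]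
      apply Real.exp_le_exp.mpr
      nlinarith
    calc c1 * (V ^ 2 * δ) ≤ (Real.exp (-5 / 2) / x) * (V ^ 2 * (δ * x / 2)) := by
          rw [hE25]
          have : 8 * c1 / x * (V ^ 2 * (δ * x / 2)) = 4 * (c1 * (V ^ 2 * δ)) := by field_simp; ring
          rw [this]
          have : 0 ≤ c1 * (V ^ 2 * δ) := by positivity
          linarith
      _ ≤ Real.exp (σ * u) * (u ^ 2 * psiErr (Real.exp (-u))) := by
          have : V ^ 2 ≤ u ^ 2 := by nlinarith
          gcongr
  · rw [abs_of_nonpos hneg] at hδx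
    refine hM (fun u => -(Real.exp (σ * u) * (u ^ 2 * psiErr (Real.exp (-u))))) C0
      (integrable_exp_mul_psiErr hσ1).neg ?_ (-V) h _ hhp fun u hu => ?_
    · intro ξ
      have := hC0 σ hσ1 hσ2 ξ
      rw [Real.fourier_real_eq_integral_exp_smul] at this ⊢
      simpa [integral_neg] using this
    have hu1 : -u ≤ V := by linarith [hu.1]
    have hu2 : V - h ≤ -u := by linarith [hu.2]
    have hexp : x * (1 - h) ≤ Real.exp (-u) := by
      calc x * (1 - h) ≤ x * Real.exp (-h) := by
            gcongr
            have := Real.add_one_le_exp (-h); linarith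
        _ = Real.exp (V - h) := by rw [sub_eq_add_neg, Real.exp_add, hxV]
        _ ≤ Real.exp (-u) := Real.exp_le_exp.mpr hu2
    have hE : δ * x / 2 ≤ -psiErr (Real.exp (-u)) := by
      have h1 : Chebyshev.psi (Real.exp (-u)) ≤ Chebyshev.psi x := by
        apply Chebyshev.psi_mono; rw [← hxV]; exact Real.exp_le_exp.mpr hu1
      have h2 := Nat.lt_floor_add_one (Real.exp (-u))
      rw [psiErr] at hδx ⊢
      have h3 : x * h = δ * x / 16 := by rw [hh]; ring
      nlinarith
    have hx3 : Real.exp (-5 / 2) / x ≤ Real.exp (σ * u) := by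
      rw [div_le_iff₀ hx0, ← hxV, ← Real.exp_add]
      apply Real.exp_le_exp.mpr
      nlinarith
    calc c1 * (V ^ 2 * δ) ≤ (Real.exp (-5 / 2) / x) * ((V / 2) ^ 2 * (δ * x / 2)) := by
          rw [hE25]
          have : 8 * c1 / x * ((V / 2) ^ 2 * (δ * x / 2)) = c1 * (V ^ 2 * δ) := by field_simp; ring
          rw [this]
      _ ≤ Real.exp (σ * u) * (u ^ 2 * -psiErr (Real.exp (-u))) := by
          have : (V / 2) ^ 2 ≤ u ^ 2 := by nlinarith
          gcongr
      _ = _ := by ring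

/-- The prime number theorem for Chebyshev's `θ`, with a logarithmic saving. -/
lemma exists_abs_theta_sub_le : ∃ C : ℝ, 0 < C ∧ ∀ x : ℝ, 1 ≤ x →
    |Chebyshev.theta x - x| * (1 + Real.log x) ≤ C * x := by
  obtain ⟨C, hC⟩ := exists_abs_psiErr_mul_log_le
  obtain ⟨K, hK⟩ := Chebyshev.psi_sub_theta_le_mul_sqrt
  refine ⟨6 + 2 * (|C| + 1 + 2 * |K|), by positivity, fun x hx => ?_⟩
  have hx0 : 0 < x := by linarith
  have hlog0 : 0 ≤ Real.log x := Real.log_nonneg hx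
  rcases lt_or_ge x (Real.exp 2) with h | h
  · have h1 : Real.log x ≤ 2 := by
      rw [Real.log_le_iff_le_exp hx0]; exact h.le
    have h2 := Chebyshev.theta_le_log4_mul_x hx0.le
    have h3 := Chebyshev.theta_nonneg x
    have h5 : Real.log 4 ≤ 2 := by
      have : (4 : ℝ) = 2 ^ 2 := by norm_num
      rw [this, Real.log_pow]; have := Real.log_two_lt_d9; push_cast; linarith
    have h4 : |Chebyshev.theta x - x| ≤ 2 * x := by
      rw [abs_le]; constructor <;> nlinarith
    have h6 : |Chebyshev.theta x - x| * (1 + Real.log x) ≤ 2 * x * 3 := by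
      gcongr; linarith
    nlinarith [abs_nonneg C, abs_nonneg K]
  · have hl2 : 2 ≤ Real.log x := by rw [Real.le_log_iff_exp_le hx0]; exact h
    have h1 := hC x h
    have h2 : Chebyshev.psi x - Chebyshev.theta x ≤ |K| * √x :=
      (hK x).trans (by gcongr; exact le_abs_self K)
    have h3 := Chebyshev.theta_le_psi x
    have hfl1 := Nat.floor_le hx0.le
    have hfl2 := Nat.lt_floor_add_one x
    have h4 : |Chebyshev.theta x - x| ≤ |psiErr x| + 1 + |K| * √x := by
      have := le_abs_self (psiErr x)
      have := neg_abs_le (psiErr x)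
      have h0 : 0 ≤ |K| * √x := by positivity
      rw [psiErr] at *
      rw [abs_le]; constructor <;> linarith
    have hs : √x * √x = x := Real.mul_self_sqrt hx0.le
    have hs0 : 0 < √x := Real.sqrt_pos.mpr hx0
    have h5 : √x * Real.log x ≤ 2 * x := by
      have : Real.log x = 2 * Real.log √x := by rw [Real.log_sqrt hx0.le]; ring
      have := Real.log_le_sub_one_of_pos hs0
      nlinarith
    have h6 : Real.log x ≤ x := Real.log_le_self hx0.le
    calc |Chebyshev.theta x - x| * (1 + Real.log x)
        ≤ (|psiErr x| + 1 + |K| * √x) * (2 * Real.log x) := by gcongr; linarith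
      _ = 2 * (|psiErr x| * Real.log x + Real.log x + |K| * (√x * Real.log x)) := by ring
      _ ≤ 2 * (|C| * x + x + |K| * (2 * x)) := by
          have h7 := h1.trans (mul_le_mul_of_nonneg_right (le_abs_self C) hx0.le)
          have h8 := mul_le_mul_of_nonneg_left h5 (abs_nonneg K)
          linarith
      _ ≤ _ := by nlinarith [abs_nonneg C, abs_nonneg K]

end PrimeNumberTheorem

section AbelSummation
open MeasureTheory

variable {ι : Type*}

/-- Partial summation comparing a weighted sum with the corresponding integral. -/
lemma sum_mul_sub_integral_eq {a b : ℝ} (hab : a ≤ b) {f f' : ℝ → ℝ}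
    (hf : ContinuousOn f (Set.Icc a b)) (hd : ∀ u ∈ Set.Ioo a b, HasDerivAt f (f' u) u)
    (hi : IntervalIntegrable f' volume a b) (J : Finset ι) (w l : ι → ℝ)
    (hJ : ∀ i ∈ J, a ≤ w i ∧ w i ≤ b) :
    ∑ i ∈ J, l i * f (w i) - ∫ u in a..b, f u =
      f b * (∑ i ∈ J, l i - (b - a)) -
        ∫ u in a..b, f' u * (∑ i ∈ J with w i ≤ u, l i - (u - a)) := by
  have hind : ∀ c, IntervalIntegrable (fun u => (Set.Ici c).indicator f' u) volume a b := by
    intro c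
    rw [intervalIntegrable_iff] at hi ⊢
    exact hi.indicator measurableSet_Ici
  have h1 : ∀ i ∈ J, l i * f (w i) =
      l i * f b - ∫ u in a..b, l i * (Set.Ici (w i)).indicator f' u := by
    intro i hi'
    obtain ⟨ha, hb⟩ := hJ i hi'
    have e1 : ∫ u in (w i)..b, f' u = f b - f (w i) :=
      intervalIntegral.integral_eq_sub_of_hasDerivAt_of_le hb (hf.mono (Set.Icc_subset_Icc_left ha))
        (fun u hu => hd u ⟨ha.trans_lt hu.1, hu.2⟩)
        (hi.mono_set (by rw [Set.uIcc_of_le hb, Set.uIcc_of_le hab]; exact Set.Icc_subset_Icc_left ha))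
    have e2 : ∫ u in a..b, (Set.Ici (w i)).indicator f' u = ∫ u in (w i)..b, f' u := by
      rw [intervalIntegral.integral_of_le hab, intervalIntegral.integral_of_le hb, ← integral_Icc_eq_integral_Ioc,
        ← integral_Icc_eq_integral_Ioc, setIntegral_indicator measurableSet_Ici]
      congr 2
      ext u; simp only [Set.mem_inter_iff, Set.mem_Icc, Set.mem_Ici]
      constructor
      · rintro ⟨⟨-, h⟩, h'⟩; exact ⟨h', h⟩
      · rintro ⟨h', h⟩; exact ⟨⟨ha.trans h', h⟩, h'⟩
    rw [intervalIntegral.integral_const_mul, e2, e1]; ring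
  have h2 : ∫ u in a..b, (f' u * (u - a) + f u) = f b * (b - a) := by
    have := intervalIntegral.integral_eq_sub_of_hasDerivAt_of_le (f := fun u => f u * (u - a))
      (f' := fun u => f' u * (u - a) + f u) hab (hf.mul (by fun_prop))
      (fun u hu => by
        have h := (hd u hu).mul ((hasDerivAt_id u).sub_const a)
        rw [id, mul_one] at h
        exact h.congr_deriv (by ring))
      ((hi.mul_continuousOn (by fun_prop)).add (hf.intervalIntegrable_of_Icc hab))
    simpa using this
  rw [intervalIntegral.integral_add (hi.mul_continuousOn (by fun_prop)) (hf.intervalIntegrable_of_Icc hab)] at h2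
  rw [Finset.sum_congr rfl h1, Finset.sum_sub_distrib, ← Finset.sum_mul,
    ← intervalIntegral.integral_finsetSum fun i _ => (hind (w i)).const_mul (l i)]
  have h3 : ∀ u, f' u * (∑ i ∈ J with w i ≤ u, l i - (u - a)) =
      ∑ i ∈ J, l i * (Set.Ici (w i)).indicator f' u - f' u * (u - a) := by
    intro u
    rw [mul_sub, Finset.mul_sum, Finset.sum_filter]
    congr 1
    refine Finset.sum_congr rfl fun i _ => ?_
    by_cases h : w i ≤ u
    · rw [if_pos h, Set.indicator_of_mem (by exact h)]; ring
    · rw [if_neg h, Set.indicator_of_notMem (by exact h)]; ring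
  simp_rw [h3]
  rw [intervalIntegral.integral_sub ?_ (hi.mul_continuousOn (by fun_prop))]
  · linear_combination -h2
  · have := IntervalIntegrable.sum J (f := fun i u => l i * (Set.Ici (w i)).indicator f' u)
      (μ := volume) (a := a) (b := b) fun i _ => (hind (w i)).const_mul (l i)
    have e : (fun u => ∑ i ∈ J, l i * (Set.Ici (w i)).indicator f' u) =
        ∑ i ∈ J, fun u => l i * (Set.Ici (w i)).indicator f' u := by
      funext u; simp
    rw [e]; exact this

lemma abs_sum_mul_sub_integral_le {a b : ℝ} (hab : a ≤ b) {f f' g : ℝ → ℝ}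
    (hf : ContinuousOn f (Set.Icc a b)) (hd : ∀ u ∈ Set.Ioo a b, HasDerivAt f (f' u) u)
    (hi : IntervalIntegrable f' volume a b) (J : Finset ι) (w l : ι → ℝ)
    (hJ : ∀ i ∈ J, a ≤ w i ∧ w i ≤ b) (hb : |∑ i ∈ J, l i - (b - a)| ≤ g b)
    (hg : ∀ u ∈ Set.Ioo a b, |∑ i ∈ J with w i ≤ u, l i - (u - a)| ≤ g u)
    (hgi : IntervalIntegrable (fun u => |f' u| * g u) volume a b) :
    |∑ i ∈ J, l i * f (w i) - ∫ u in a..b, f u| ≤ |f b| * g b + ∫ u in a..b, |f' u| * g u := by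
  rw [sum_mul_sub_integral_eq hab hf hd hi J w l hJ]
  refine (abs_sub _ _).trans (add_le_add ?_ ?_)
  · rw [abs_mul]; gcongr
  · rw [intervalIntegral.integral_of_le hab, intervalIntegral.integral_of_le hab, integral_Ioc_eq_integral_Ioo,
      integral_Ioc_eq_integral_Ioo, ← Real.norm_eq_abs]
    rw [intervalIntegrable_iff_integrableOn_Ioo_of_le hab] at hgi
    refine norm_integral_le_of_norm_le hgi ?_
    refine (ae_restrict_iff' measurableSet_Ioo).mpr (Eventually.of_forall fun u hu => ?_)
    rw [Real.norm_eq_abs, abs_mul]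
    gcongr
    exact hg u hu

end AbelSummation

section NearUniformFamilies
open MeasureTheory

variable {ι : Type*}

/-- The shape of the admissible error in the counting function of a nearly uniform family. -/
noncomputable def errWeight (δ u : ℝ) : ℝ := u + u ^ (1 - δ)

/-- A finite weighted family of positive reals whose counting function is close to the identity
on `(0, B]`. -/
structure NearUniform (I : Finset ι) (w l : ι → ℝ) (B ε δ : ℝ) : Prop where
  pos : ∀ i ∈ I, 0 < w i
  nonneg : ∀ i ∈ I, 0 ≤ l i
  le : ∀ u, 0 < u → u ≤ B → |∑ i ∈ I with w i ≤ u, l i - u| ≤ ε * errWeight δ u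
  lt : ∀ u, 0 < u → u ≤ B → |∑ i ∈ I with w i < u, l i - u| ≤ ε * errWeight δ u
  eps_nonneg : 0 ≤ ε
  eps_le_one : ε ≤ 1
  delta_nonneg : 0 ≤ δ
  delta_le_one : δ ≤ 1

lemma errWeight_nonneg {δ u : ℝ} (hu : 0 ≤ u) : 0 ≤ errWeight δ u :=
  add_nonneg hu (Real.rpow_nonneg hu _)

lemma errWeight_mono {δ u v : ℝ} (hδ : δ ≤ 1) (hu : 0 ≤ u) (huv : u ≤ v) :
    errWeight δ u ≤ errWeight δ v :=
  add_le_add huv (Real.rpow_le_rpow hu huv (by linarith))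

lemma le_errWeight {δ u : ℝ} (hu : 0 ≤ u) : u ≤ errWeight δ u :=
  le_add_of_nonneg_right (Real.rpow_nonneg hu _)

lemma rpow_neg_mul_errWeight {δ u s : ℝ} (hu : 0 < u) :
    u ^ (-s) * errWeight δ u = u ^ (1 - s) + u ^ (1 - s - δ) := by
  rw [errWeight, mul_add]
  congr 1
  · rw [sub_eq_neg_add, Real.rpow_add hu, Real.rpow_one]
  · rw [← Real.rpow_add hu]; congr 1; ring

lemma rpow_neg_mul_errWeight_anti {δ u v s : ℝ} (hδ : 0 ≤ δ) (hs : 1 ≤ s) (hu : 0 < u) (huv : u ≤ v) :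
    v ^ (-s) * errWeight δ v ≤ u ^ (-s) * errWeight δ u := by
  rw [rpow_neg_mul_errWeight hu, rpow_neg_mul_errWeight (hu.trans_le huv)]
  exact add_le_add (Real.rpow_le_rpow_of_nonpos hu huv (by linarith))
    (Real.rpow_le_rpow_of_nonpos hu huv (by linarith))

namespace NearUniform

variable {I J : Finset ι} {w l : ι → ℝ} {B ε δ : ℝ}

lemma abs_sum_sub_le (H : NearUniform I w l B ε δ) {b : ℝ} (hb : 0 < b) (hbB : b ≤ B) (hJI : J ⊆ I)
    (h1 : ∀ i ∈ J, w i ≤ b) (h2 : ∀ i ∈ I, w i < b → i ∈ J) :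
    |∑ i ∈ J, l i - b| ≤ ε * errWeight δ b := by
  have e1 := abs_le.mp (H.le b hb hbB)
  have e2 := abs_le.mp (H.lt b hb hbB)
  have e3 : ∑ i ∈ J, l i ≤ ∑ i ∈ I with w i ≤ b, l i :=
    Finset.sum_le_sum_of_subset_of_nonneg
      (fun i hi => Finset.mem_filter.mpr ⟨hJI hi, h1 i hi⟩)
      (fun i hi _ => H.nonneg i (Finset.mem_filter.mp hi).1)
  have e4 : ∑ i ∈ I with w i < b, l i ≤ ∑ i ∈ J, l i :=
    Finset.sum_le_sum_of_subset_of_nonneg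
      (fun i hi => h2 i (Finset.mem_filter.mp hi).1 (Finset.mem_filter.mp hi).2)
      (fun i hi _ => H.nonneg i (hJI hi))
  rw [abs_le]; constructor <;> linarith

lemma abs_sum_rpow_sub_le (H : NearUniform I w l B ε δ) {b γ : ℝ} (hb : 0 < b) (hbB : b ≤ B)
    (hγ : 0 < γ) (hJI : J ⊆ I) (h1 : ∀ i ∈ J, w i ≤ b) (h2 : ∀ i ∈ I, w i < b → i ∈ J) :
    |∑ i ∈ J, l i * w i ^ γ - b ^ (γ + 1) / (γ + 1)| ≤ 2 * ε * (errWeight δ b * b ^ γ) := by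
  have hi : IntervalIntegrable (fun u : ℝ => γ * u ^ (γ - 1)) volume 0 b :=
    (intervalIntegral.intervalIntegrable_rpow' (by linarith)).const_mul γ
  have h := abs_sum_mul_sub_integral_le hb.le (f := fun u => u ^ γ) (f' := fun u => γ * u ^ (γ - 1))
    (g := fun _ => ε * errWeight δ b)
    (Real.continuous_rpow_const hγ.le).continuousOn
    (fun u hu => Real.hasDerivAt_rpow_const (Or.inl hu.1.ne')) hi J w l
    (fun i hi => ⟨(H.pos i (hJI hi)).le, h1 i hi⟩)
    (by simpa using H.abs_sum_sub_le hb hbB hJI h1 h2) ?_ (hi.abs.mul_const _)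
  · have e : ∫ u in (0 : ℝ)..b, |γ * u ^ (γ - 1)| * (ε * errWeight δ b) = b ^ γ * (ε * errWeight δ b) := by
      rw [intervalIntegral.integral_mul_const]
      congr 1
      calc ∫ u in (0 : ℝ)..b, |γ * u ^ (γ - 1)| = ∫ u in (0 : ℝ)..b, γ * u ^ (γ - 1) := by
            refine intervalIntegral.integral_congr fun u hu => ?_
            rw [Set.uIcc_of_le hb.le] at hu
            exact abs_of_nonneg (mul_nonneg hγ.le (Real.rpow_nonneg hu.1 _))
        _ = b ^ γ := by
            rw [intervalIntegral.integral_const_mul, integral_rpow (Or.inl (by linarith)),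
              sub_add_cancel, Real.zero_rpow hγ.ne', sub_zero]
            field_simp
    rw [e, integral_rpow (Or.inl (by linarith)), Real.zero_rpow (by linarith), sub_zero,
      abs_of_nonneg (Real.rpow_nonneg hb.le _)] at h
    linarith
  · intro u hu
    have e : J.filter (fun i => w i ≤ u) = I.filter (fun i => w i ≤ u) := by
      ext i; simp only [Finset.mem_filter]
      exact ⟨fun hi => ⟨hJI hi.1, hi.2⟩, fun hi => ⟨h2 i hi.1 (hi.2.trans_lt hu.2), hi.2⟩⟩
    rw [e, sub_zero]
    exact (H.le u hu.1 (hu.2.le.trans hbB)).trans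
      (mul_le_mul_of_nonneg_left (errWeight_mono H.delta_le_one hu.1.le hu.2.le) H.eps_nonneg)

lemma abs_sum_rpow_neg_sub_le (H : NearUniform I w l B ε δ) {a b s : ℝ} (ha : 0 < a) (hab : a ≤ b)
    (hbB : b ≤ B) (hs : 1 < s) (hJI : J ⊆ I) (h1 : ∀ i ∈ J, a < w i ∧ w i ≤ b)
    (h2 : ∀ i ∈ I, a < w i → w i < b → i ∈ J) :
    |∑ i ∈ J, l i * w i ^ (-s) - (a ^ (1 - s) - b ^ (1 - s)) / (s - 1)| ≤
      (2 + 2 * s / (s - 1)) * ε * (a ^ (-s) * errWeight δ a) := by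
  classical
  have hb : 0 < b := ha.trans_le hab
  have hε := H.eps_nonneg
  have hδ := H.delta_nonneg
  have h0 : (0 : ℝ) ∉ Set.uIcc a b := by
    rw [Set.uIcc_of_le hab]; exact fun h => absurd h.1 (not_le.mpr ha)
  have hi : IntervalIntegrable (fun u : ℝ => -s * u ^ (-s - 1)) volume a b :=
    (intervalIntegral.intervalIntegrable_rpow (Or.inr h0)).const_mul _
  have hNa := abs_le.mp (H.le a ha (hab.trans hbB))
  have split : ∀ u, a ≤ u → ∀ K : Finset ι, K ⊆ I → (∀ i ∈ K, a < w i ∧ w i ≤ u) →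
      (∀ i ∈ I, a < w i → w i < u → i ∈ K) → u ≤ B →
      |∑ i ∈ K, l i - (u - a)| ≤ 2 * ε * errWeight δ u := by
    intro u hau K hKI k1 k2 huB
    have hm : ∑ i ∈ K ∪ I.filter (fun i => w i ≤ a), l i = ∑ i ∈ K, l i + ∑ i ∈ I with w i ≤ a, l i := by
      refine Finset.sum_union (Finset.disjoint_left.mpr fun i hi hi' => ?_)
      exact absurd (k1 i hi).1 (not_lt.mpr (Finset.mem_filter.mp hi').2)
    have := H.abs_sum_sub_le (J := K ∪ I.filter (fun i => w i ≤ a)) (ha.trans_le hau) huB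
      (Finset.union_subset hKI (Finset.filter_subset _ _)) ?_ ?_
    · rw [hm] at this
      have h3 := errWeight_mono H.delta_le_one ha.le hau
      have h4 := mul_le_mul_of_nonneg_left h3 hε
      rw [abs_le] at this ⊢
      constructor <;> linarith
    · intro i hi
      rcases Finset.mem_union.mp hi with h | h
      · exact (k1 i h).2
      · exact (Finset.mem_filter.mp h).2.trans hau
    · intro i hi hiu
      by_cases h : a < w i
      · exact Finset.mem_union_left _ (k2 i hi h hiu)
      · exact Finset.mem_union_right _ (Finset.mem_filter.mpr ⟨hi, not_lt.mp h⟩)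
  have hcont : ContinuousOn (fun u : ℝ => errWeight δ u) (Set.uIcc a b) := by
    refine continuousOn_id.add (continuousOn_id.rpow_const fun u hu => Or.inl ?_)
    rintro rfl; exact h0 hu
  have h := abs_sum_mul_sub_integral_le hab (f := fun u => u ^ (-s)) (f' := fun u => -s * u ^ (-s - 1))
    (g := fun u => 2 * ε * errWeight δ u)
    (continuousOn_id.rpow_const fun u hu => Or.inl (ha.trans_le hu.1).ne')
    (fun u hu => Real.hasDerivAt_rpow_const (Or.inl (ha.trans hu.1).ne')) hi J w l
    (fun i hi => ⟨(h1 i hi).1.le, (h1 i hi).2⟩)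
    (split b hab J hJI h1 h2 hbB) ?_ (hi.abs.mul_continuousOn (hcont.const_mul _))
  · have e1 : ∫ u in a..b, |-s * u ^ (-s - 1)| * (2 * ε * errWeight δ u) ≤
        2 * s / (s - 1) * ε * (a ^ (-s) * errWeight δ a) := by
      have hI : ∀ t : ℝ, IntervalIntegrable (fun u : ℝ => u ^ t) volume a b := fun t =>
        intervalIntegral.intervalIntegrable_rpow (Or.inr h0)
      calc ∫ u in a..b, |-s * u ^ (-s - 1)| * (2 * ε * errWeight δ u)
          = ∫ u in a..b, (2 * s * ε) * (u ^ (-s) + u ^ (-s - δ)) := by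
            refine intervalIntegral.integral_congr fun u hu => ?_
            rw [Set.uIcc_of_le hab] at hu
            have hu0 : 0 < u := ha.trans_le hu.1
            have := rpow_neg_mul_errWeight (δ := δ) (s := s + 1) hu0
            rw [abs_mul, abs_neg, abs_of_pos (by linarith : 0 < s), abs_of_nonneg (Real.rpow_nonneg hu0.le _)]
            rw [show -s - 1 = -(s + 1) by ring]
            rw [show 1 - (s + 1) = -s by ring] at this
            rw [← this]; ring
        _ = (2 * s * ε) * ((a ^ (1 - s) - b ^ (1 - s)) / (s - 1) +
              (a ^ (1 - s - δ) - b ^ (1 - s - δ)) / (s + δ - 1)) := by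
            rw [intervalIntegral.integral_const_mul, intervalIntegral.integral_add (hI _) (hI _),
              integral_rpow (Or.inr ⟨by linarith, h0⟩), integral_rpow (Or.inr ⟨by linarith, h0⟩)]
            rw [show -s + 1 = 1 - s by ring, show -s - δ + 1 = 1 - s - δ by ring]
            have d1 : s - 1 ≠ 0 := by linarith
            have d2 : s + δ - 1 ≠ 0 := by linarith
            have d3 : 1 - s ≠ 0 := by linarith
            have d4 : 1 - s - δ ≠ 0 := by linarith
            congr 2
            · rw [div_eq_div_iff d3 d1]; ring
            · rw [div_eq_div_iff d4 d2]; ring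
        _ ≤ (2 * s * ε) * (a ^ (1 - s) / (s - 1) + a ^ (1 - s - δ) / (s - 1)) := by
            have hs1 : 0 < s - 1 := by linarith
            gcongr
            · have := Real.rpow_nonneg hb.le (1 - s); linarith
            · have := Real.rpow_nonneg hb.le (1 - s - δ); linarith
            · linarith
        _ = _ := by rw [rpow_neg_mul_errWeight ha]; field_simp
    have e2 : |b ^ (-s)| * (2 * ε * errWeight δ b) ≤ 2 * ε * (a ^ (-s) * errWeight δ a) := by
      rw [abs_of_nonneg (Real.rpow_nonneg hb.le _)]
      have := mul_le_mul_of_nonneg_left (rpow_neg_mul_errWeight_anti hδ hs.le ha hab)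
        (by linarith : 0 ≤ 2 * ε)
      linarith
    have e3 : ∫ u in a..b, u ^ (-s) = (a ^ (1 - s) - b ^ (1 - s)) / (s - 1) := by
      rw [integral_rpow (Or.inr ⟨by linarith, h0⟩), show -s + 1 = 1 - s by ring,
        div_eq_div_iff (by linarith) (by linarith)]
      ring
    rw [e3] at h
    refine h.trans ((add_le_add e2 e1).trans (le_of_eq ?_))
    ring
  · intro u hu
    refine split u hu.1.le _ ((Finset.filter_subset _ _).trans hJI) ?_ ?_ (hu.2.le.trans hbB)
    · intro i hi
      have := Finset.mem_filter.mp hi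
      exact ⟨(h1 i this.1).1, this.2⟩
    · intro i hi hai hiu
      exact Finset.mem_filter.mpr ⟨h2 i hi hai (hiu.trans hu.2), hiu.le⟩

lemma sum_rpow_le (H : NearUniform I w l B ε δ) {b γ : ℝ} (hb : 0 < b) (hbB : b ≤ B)
    (hγ : 0 ≤ γ) (hJI : J ⊆ I) (h1 : ∀ i ∈ J, w i ≤ b) :
    ∑ i ∈ J, l i * w i ^ γ ≤ 2 * (errWeight δ b * b ^ γ) := by
  have e1 := (abs_le.mp (H.le b hb hbB)).2
  have e3 : ∑ i ∈ J, l i ≤ ∑ i ∈ I with w i ≤ b, l i :=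
    Finset.sum_le_sum_of_subset_of_nonneg
      (fun i hi => Finset.mem_filter.mpr ⟨hJI hi, h1 i hi⟩)
      (fun i hi _ => H.nonneg i (Finset.mem_filter.mp hi).1)
  have e4 := le_errWeight (δ := δ) hb.le
  have e5 : ε * errWeight δ b ≤ 1 * errWeight δ b :=
    mul_le_mul_of_nonneg_right H.eps_le_one (errWeight_nonneg hb.le)
  calc ∑ i ∈ J, l i * w i ^ γ ≤ ∑ i ∈ J, l i * b ^ γ := by
        refine Finset.sum_le_sum fun i hi => ?_
        exact mul_le_mul_of_nonneg_left
          (Real.rpow_le_rpow (H.pos i (hJI hi)).le (h1 i hi) hγ) (H.nonneg i (hJI hi))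
    _ = (∑ i ∈ J, l i) * b ^ γ := by rw [Finset.sum_mul]
    _ ≤ (2 * errWeight δ b) * b ^ γ := by
        refine mul_le_mul_of_nonneg_right ?_ (Real.rpow_nonneg hb.le _)
        linarith
    _ = _ := by ring

lemma sum_rpow_neg_le (H : NearUniform I w l B ε δ) {a b s : ℝ} (ha : 0 < a) (hab : a ≤ b)
    (hbB : b ≤ B) (hs : 1 < s) (hJI : J ⊆ I) (h1 : ∀ i ∈ J, a < w i ∧ w i ≤ b) :
    ∑ i ∈ J, l i * w i ^ (-s) ≤ (2 + (2 * s + 1) / (s - 1)) * (a ^ (-s) * errWeight δ a) := by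
  have h := H.abs_sum_rpow_neg_sub_le (J := I.filter (fun i => a < w i ∧ w i ≤ b)) ha hab hbB hs
    (Finset.filter_subset _ _) (fun i hi => (Finset.mem_filter.mp hi).2)
    (fun i hi hai hib => Finset.mem_filter.mpr ⟨hi, hai, hib.le⟩)
  have e3 : ∑ i ∈ J, l i * w i ^ (-s) ≤ ∑ i ∈ I with a < w i ∧ w i ≤ b, l i * w i ^ (-s) :=
    Finset.sum_le_sum_of_subset_of_nonneg
      (fun i hi => Finset.mem_filter.mpr ⟨hJI hi, h1 i hi⟩)
      (fun i hi _ => mul_nonneg (H.nonneg i (Finset.mem_filter.mp hi).1)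
        (Real.rpow_nonneg (H.pos i (Finset.mem_filter.mp hi).1).le _))
  have hs1 : 0 < s - 1 := by linarith
  have hW : 0 ≤ a ^ (-s) * errWeight δ a :=
    mul_nonneg (Real.rpow_nonneg ha.le _) (errWeight_nonneg ha.le)
  have e4 : (2 + 2 * s / (s - 1)) * ε * (a ^ (-s) * errWeight δ a) ≤
      (2 + 2 * s / (s - 1)) * 1 * (a ^ (-s) * errWeight δ a) := by
    have : 0 ≤ 2 + 2 * s / (s - 1) := by positivity
    gcongr
    exact H.eps_le_one
  have e5 : (a ^ (1 - s) - b ^ (1 - s)) / (s - 1) ≤ 1 / (s - 1) * (a ^ (-s) * errWeight δ a) := by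
    rw [rpow_neg_mul_errWeight ha, div_eq_mul_one_div, mul_comm]
    have := Real.rpow_nonneg (ha.trans_le hab).le (1 - s)
    have := Real.rpow_nonneg ha.le (1 - s - δ)
    gcongr
    linarith
  have e6 := (abs_le.mp h).2
  have e7 : (2 + (2 * s + 1) / (s - 1)) * (a ^ (-s) * errWeight δ a) =
      (2 + 2 * s / (s - 1)) * 1 * (a ^ (-s) * errWeight δ a) + 1 / (s - 1) * (a ^ (-s) * errWeight δ a) := by
    rw [add_div]; ring
  linarith

end NearUniform

end NearUniformFamilies

section TripleSum

namespace NearUniform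

variable {ι : Type*}

/-- The sum over the smallest index of the triple. -/
noncomputable def innerSum (I : Finset ι) (w l : ι → ℝ) (α : ℝ) (q r : ι) : ℝ :=
  ∑ p ∈ I with w p < w q ∧ w p * w q * w r ≤ 1, l p * w p ^ α

/-- The sum over the two smaller indices of the triple. -/
noncomputable def midSum (I : Finset ι) (w l : ι → ℝ) (α : ℝ) (r : ι) : ℝ :=
  ∑ q ∈ I with w q < w r, l q * innerSum I w l α q r

/-- The weighted sum over triples `w p < w q < w r` with `w p * w q * w r ≤ 1`. -/
noncomputable def tripleSum (I : Finset ι) (w l : ι → ℝ) (α : ℝ) : ℝ :=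
  ∑ r ∈ I, l r * (w r ^ (-α) * midSum I w l α r)

variable {I J : Finset ι} {w l : ι → ℝ} {B ε δ α : ℝ}

lemma abs_innerSum_sub_le_of_le (H : NearUniform I w l B ε δ) (hα : 0 < α) {q r : ι} (hq : q ∈ I)
    (hr : r ∈ I) (hqB : w q ≤ B) (hqr : w q * w q * w r ≤ 1) :
    |innerSum I w l α q r - w q ^ (α + 1) / (α + 1)| ≤
      2 * ε * (errWeight δ (w q) * w q ^ α) := by
  refine H.abs_sum_rpow_sub_le (H.pos q hq) hqB hα (Finset.filter_subset _ _) ?_ ?_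
  · exact fun i hi => (Finset.mem_filter.mp hi).2.1.le
  · refine fun i hi hiq => Finset.mem_filter.mpr ⟨hi, hiq, le_trans ?_ hqr⟩
    have := H.pos q hq
    have := H.pos r hr
    gcongr

lemma abs_innerSum_sub_le_of_ge (H : NearUniform I w l B ε δ) (hα : 0 < α) {q r : ι} (hq : q ∈ I)
    (hr : r ∈ I) (hqB : w q ≤ B) (hqr : 1 ≤ w q * w q * w r) :
    |innerSum I w l α q r - (w q * w r) ^ (-(α + 1)) / (α + 1)| ≤
      2 * ε * ((w q * w r) ^ (-(α + 1)) + (w q * w r) ^ (-(α + 1 - δ))) := by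
  have hq0 := H.pos q hq
  have hr0 := H.pos r hr
  have hm : 0 < w q * w r := mul_pos hq0 hr0
  have hb : (w q * w r)⁻¹ ≤ w q := by
    rw [inv_le_iff_one_le_mul₀ hm]; linarith
  have h := H.abs_sum_rpow_sub_le (J := I.filter fun p => w p < w q ∧ w p * w q * w r ≤ 1)
    (inv_pos.mpr hm) (hb.trans hqB) hα (Finset.filter_subset _ _) ?_ ?_
  · rw [errWeight, add_mul, ← Real.rpow_add (inv_pos.mpr hm), ← Real.rpow_one_add' (inv_pos.mpr hm).le
      (by linarith), Real.inv_rpow hm.le, Real.inv_rpow hm.le, Real.inv_rpow hm.le,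
      ← Real.rpow_neg hm.le, ← Real.rpow_neg hm.le, ← Real.rpow_neg hm.le,
      show -(1 + α) = -(α + 1) by ring, show -(1 - δ + α) = -(α + 1 - δ) by ring] at h
    exact h
  · intro i hi
    have := (Finset.mem_filter.mp hi).2.2
    rw [le_inv_comm₀ (H.pos i (Finset.mem_filter.mp hi).1) hm, inv_eq_one_div,
      le_div_iff₀ (H.pos i (Finset.mem_filter.mp hi).1)]
    linarith
  · intro i hi hib
    refine Finset.mem_filter.mpr ⟨hi, hib.trans_le hb, ?_⟩
    have := mul_le_mul_of_nonneg_right hib.le hm.le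
    rw [inv_mul_cancel₀ hm.ne'] at this
    linarith

lemma abs_sum_mul_sub_le_of_small (H : NearUniform I w l B ε δ) (hα : 0 < α) {b : ℝ} (hb : 0 < b)
    (hbB : b ≤ B) (hb1 : b ≤ 1) (hJI : J ⊆ I) (h1 : ∀ i ∈ J, w i ≤ b)
    (h2 : ∀ i ∈ I, w i < b → i ∈ J) (P : ι → ℝ)
    (hP : ∀ q ∈ J, |P q - w q ^ (α + 1) / (α + 1)| ≤ 2 * ε * (errWeight δ (w q) * w q ^ α)) :
    |∑ q ∈ J, l q * P q - b ^ (α + 2) / ((α + 1) * (α + 2))| ≤ 24 * ε * b ^ (α + 2 - 2 * δ) := by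
  have hε := H.eps_nonneg
  have hδ := H.delta_nonneg
  have hW := errWeight_nonneg (δ := δ) hb.le
  have hWb := le_errWeight (δ := δ) hb.le
  have hbα : 0 ≤ b ^ α := Real.rpow_nonneg hb.le _
  have e1 := H.abs_sum_rpow_sub_le (γ := α + 1) hb hbB (by linarith) hJI h1 h2
  have e2 := H.sum_rpow_le hb hbB hα.le hJI h1
  have e3 : |∑ q ∈ J, l q * P q - ∑ q ∈ J, l q * (w q ^ (α + 1) / (α + 1))| ≤
      4 * ε * (errWeight δ b * errWeight δ b * b ^ α) := by
    rw [← Finset.sum_sub_distrib]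
    calc |∑ q ∈ J, (l q * P q - l q * (w q ^ (α + 1) / (α + 1)))|
        ≤ ∑ q ∈ J, |l q * P q - l q * (w q ^ (α + 1) / (α + 1))| := Finset.abs_sum_le_sum_abs _ _
      _ ≤ ∑ q ∈ J, 2 * ε * errWeight δ b * (l q * w q ^ α) := by
          refine Finset.sum_le_sum fun q hq => ?_
          have hl := H.nonneg q (hJI hq)
          have hq0 := (H.pos q (hJI hq)).le
          rw [← mul_sub, abs_mul, abs_of_nonneg hl]
          have h3 := errWeight_mono H.delta_le_one hq0 (h1 q hq)
          have h4 : 0 ≤ w q ^ α := Real.rpow_nonneg hq0 _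
          calc l q * |P q - w q ^ (α + 1) / (α + 1)|
              ≤ l q * (2 * ε * (errWeight δ (w q) * w q ^ α)) :=
                mul_le_mul_of_nonneg_left (hP q hq) hl
            _ ≤ l q * (2 * ε * (errWeight δ b * w q ^ α)) := by gcongr
            _ = _ := by ring
      _ = 2 * ε * errWeight δ b * ∑ q ∈ J, (l q * w q ^ α) := by rw [Finset.mul_sum]
      _ ≤ 2 * ε * errWeight δ b * (2 * (errWeight δ b * b ^ α)) := by gcongr
      _ = _ := by ring
  have e4 : ∑ q ∈ J, l q * (w q ^ (α + 1) / (α + 1)) = (∑ q ∈ J, l q * w q ^ (α + 1)) / (α + 1) := by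
    rw [Finset.sum_div]; exact Finset.sum_congr rfl fun _ _ => by ring
  have e5 : |(∑ q ∈ J, l q * w q ^ (α + 1)) / (α + 1) - b ^ (α + 2) / ((α + 1) * (α + 2))| ≤
      2 * ε * (errWeight δ b * errWeight δ b * b ^ α) := by
    have : (∑ q ∈ J, l q * w q ^ (α + 1)) / (α + 1) - b ^ (α + 2) / ((α + 1) * (α + 2)) =
        (∑ q ∈ J, l q * w q ^ (α + 1) - b ^ (α + 1 + 1) / (α + 1 + 1)) / (α + 1) := by
      rw [show α + 1 + 1 = α + 2 by ring]; field_simp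
    rw [this, abs_div, abs_of_pos (by linarith : 0 < α + 1)]
    refine (div_le_self (abs_nonneg _) (by linarith)).trans (e1.trans ?_)
    rw [Real.rpow_add hb, Real.rpow_one]
    have := mul_le_mul_of_nonneg_left hWb (mul_nonneg hW hbα)
    have := mul_le_mul_of_nonneg_left this (by linarith : 0 ≤ 2 * ε)
    linarith
  have e6 : errWeight δ b * errWeight δ b * b ^ α ≤ 4 * b ^ (α + 2 - 2 * δ) := by
    have h3 : errWeight δ b ≤ 2 * b ^ (1 - δ) := by
      have := Real.rpow_le_rpow_of_exponent_ge hb hb1 (by linarith : 1 - δ ≤ 1)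
      rw [Real.rpow_one] at this
      rw [errWeight]; linarith
    have h4 : b ^ (α + 2 - 2 * δ) = b ^ (1 - δ) * b ^ (1 - δ) * b ^ α := by
      rw [← Real.rpow_add hb, ← Real.rpow_add hb]; congr 1; ring
    rw [h4]
    have : errWeight δ b * errWeight δ b ≤ (2 * b ^ (1 - δ)) * (2 * b ^ (1 - δ)) :=
      mul_le_mul h3 h3 hW (hW.trans h3)
    have := mul_le_mul_of_nonneg_right this hbα
    linarith
  rw [e4] at e3
  have e7 := mul_le_mul_of_nonneg_left e6 (by linarith : 0 ≤ 6 * ε)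
  have := (abs_sub_le _ _ _).trans (add_le_add e3 e5)
  linarith

lemma abs_midSum_sub_le_of_le_one (H : NearUniform I w l B ε δ) (hα : 0 < α) {r : ι} (hr : r ∈ I)
    (hrB : w r ≤ B) (hr1 : w r ≤ 1) :
    |midSum I w l α r - w r ^ (α + 2) / ((α + 1) * (α + 2))| ≤
      24 * ε * w r ^ (α + 2 - 2 * δ) := by
  refine H.abs_sum_mul_sub_le_of_small hα (H.pos r hr) hrB hr1 (Finset.filter_subset _ _) ?_ ?_ _ ?_
  · exact fun i hi => (Finset.mem_filter.mp hi).2.le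
  · exact fun i hi h => Finset.mem_filter.mpr ⟨hi, h⟩
  · intro q hq
    have hq' := Finset.mem_filter.mp hq
    have := H.pos q hq'.1
    have := H.pos r hr
    refine H.abs_innerSum_sub_le_of_le hα hq'.1 hr (hq'.2.le.trans hrB) ?_
    calc w q * w q * w r ≤ 1 * 1 * 1 := by
          have := hq'.2.le.trans hr1
          gcongr
      _ = 1 := by norm_num

end NearUniform
end TripleSum

section TripleSumMain

namespace NearUniform

variable {ι : Type*} {I J : Finset ι} {w l : ι → ℝ} {B ε δ α : ℝ}

lemma abs_midSum_sub_le_of_one_lt (H : NearUniform I w l B ε δ) (hδα : δ < α) {r : ι} (hr : r ∈ I)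
    (hrB : w r ≤ B) (hr1 : 1 < w r) :
    |midSum I w l α r - ((1 / ((α + 1) * (α + 2)) + 1 / (α * (α + 1))) * w r ^ (-(α / 2 + 1)) -
        1 / (α * (α + 1)) * w r ^ (-(2 * α + 1)))| ≤
      (24 + 2 * (2 + 2 * (α + 1) / α) + 4 * (2 + (2 * (α + 1) + 1) / α) +
        4 * (2 + (2 * (α + 1 - δ) + 1) / (α - δ))) * ε * w r ^ (-(α / 2 + 1 - δ)) := by
  classical
  have hδ := H.delta_nonneg
  have hε := H.eps_nonneg
  have hα : 0 < α := by linarith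
  set R := w r with hR
  have hR0 : 0 < R := by linarith
  set y := R ^ (-(1 / 2) : ℝ) with hy
  have hy0 : 0 < y := Real.rpow_pos_of_pos hR0 _
  have hy1 : y < 1 := Real.rpow_lt_one_of_one_lt_of_neg hr1 (by norm_num)
  have hyy : y * y * R = 1 := by
    rw [hy, ← Real.rpow_add hR0, ← Real.rpow_add_one hR0.ne']; norm_num
  have hypow : ∀ t : ℝ, y ^ t = R ^ (-(t / 2)) := fun t => by
    rw [hy, ← Real.rpow_mul hR0.le]; congr 1; ring
  have hRy : ∀ s t : ℝ, R ^ s * y ^ t = R ^ (s - t / 2) := fun s t => by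
    rw [hypow, ← Real.rpow_add hR0]; congr 1
  set E := R ^ (-(α / 2 + 1 - δ)) with hE
  have hle : ∀ s : ℝ, s ≤ -(α / 2 + 1 - δ) → R ^ s ≤ E := fun s hs =>
    Real.rpow_le_rpow_of_exponent_le hr1.le hs
  set J1 := I.filter fun q => w q ≤ y with hJ1
  set J2 := I.filter fun q => y < w q ∧ w q < R with hJ2
  have hJ2I : J2 ⊆ I := Finset.filter_subset _ _
  have hJ2' : ∀ q ∈ J2, y < w q ∧ w q ≤ R := fun q hq =>
    ⟨(Finset.mem_filter.mp hq).2.1, (Finset.mem_filter.mp hq).2.2.le⟩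
  have hsplit : midSum I w l α r = ∑ q ∈ J1, l q * innerSum I w l α q r +
      ∑ q ∈ J2, l q * innerSum I w l α q r := by
    rw [midSum, ← Finset.sum_union]
    · refine Finset.sum_congr ?_ fun _ _ => rfl
      ext q
      simp only [hJ1, hJ2, Finset.mem_union, Finset.mem_filter]
      constructor
      · rintro ⟨h1, h2⟩
        by_cases h : w q ≤ y
        · exact Or.inl ⟨h1, h⟩
        · exact Or.inr ⟨h1, not_le.mp h, h2⟩
      · rintro (⟨h1, h2⟩ | ⟨h1, h2, h3⟩)
        · exact ⟨h1, by linarith⟩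
        · exact ⟨h1, h3⟩
    · refine Finset.disjoint_left.mpr fun q h1 h2 => ?_
      exact absurd (Finset.mem_filter.mp h1).2 (not_le.mpr (hJ2' q h2).1)
  have p1 : |∑ q ∈ J1, l q * innerSum I w l α q r - y ^ (α + 2) / ((α + 1) * (α + 2))| ≤
      24 * ε * y ^ (α + 2 - 2 * δ) := by
    refine H.abs_sum_mul_sub_le_of_small hα hy0 (by linarith) hy1.le (Finset.filter_subset _ _)
      (fun i hi => (Finset.mem_filter.mp hi).2)
      (fun i hi h => Finset.mem_filter.mpr ⟨hi, h.le⟩) _ ?_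
    intro q hq
    have hq' := Finset.mem_filter.mp hq
    have hq0 := H.pos q hq'.1
    refine H.abs_innerSum_sub_le_of_le hα hq'.1 hr (by linarith) ?_
    rw [← hyy]
    have := hq'.2
    gcongr
  set S1 := ∑ q ∈ J2, l q * w q ^ (-(α + 1)) with hS1
  set S2 := ∑ q ∈ J2, l q * w q ^ (-(α + 1 - δ)) with hS2
  have p2 : |∑ q ∈ J2, l q * innerSum I w l α q r - R ^ (-(α + 1)) / (α + 1) * S1| ≤
      2 * ε * (R ^ (-(α + 1)) * S1 + R ^ (-(α + 1 - δ)) * S2) := by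
    rw [hS1, hS2, Finset.mul_sum, Finset.mul_sum, Finset.mul_sum, ← Finset.sum_sub_distrib,
      ← Finset.sum_add_distrib, Finset.mul_sum]
    refine (Finset.abs_sum_le_sum_abs _ _).trans (Finset.sum_le_sum fun q hq => ?_)
    have hq0 := H.pos q (hJ2I hq)
    have hl := H.nonneg q (hJ2I hq)
    have hge : 1 ≤ w q * w q * R := by
      rw [← hyy]
      have := (hJ2' q hq).1.le
      gcongr
    have h := H.abs_innerSum_sub_le_of_ge hα (hJ2I hq) hr ((hJ2' q hq).2.trans hrB) hge
    rw [← hR, Real.mul_rpow hq0.le hR0.le, Real.mul_rpow hq0.le hR0.le] at h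
    calc |l q * innerSum I w l α q r - R ^ (-(α + 1)) / (α + 1) * (l q * w q ^ (-(α + 1)))|
        = l q * |innerSum I w l α q r - w q ^ (-(α + 1)) * R ^ (-(α + 1)) / (α + 1)| := by
          rw [← abs_of_nonneg hl, ← abs_mul, abs_of_nonneg hl]; congr 1; ring
      _ ≤ _ := (mul_le_mul_of_nonneg_left h hl).trans (le_of_eq (by ring))
  have s1 := H.abs_sum_rpow_neg_sub_le (s := α + 1) hy0 (by linarith) hrB (by linarith) hJ2I hJ2'
    (fun i hi h1 h2 => Finset.mem_filter.mpr ⟨hi, h1, h2⟩)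
  have s2 := H.sum_rpow_neg_le (s := α + 1) hy0 (by linarith) hrB (by linarith) hJ2I hJ2'
  have s3 := H.sum_rpow_neg_le (s := α + 1 - δ) hy0 (by linarith) hrB (by linarith) hJ2I hJ2'
  rw [rpow_neg_mul_errWeight hy0] at s1 s2 s3
  rw [← hS1] at s1 s2
  rw [← hS2] at s3
  rw [show α + 1 - 1 = α by ring, show 1 - (α + 1) = -α by ring] at s1 s2
  rw [show α + 1 - δ - 1 = α - δ by ring, show 1 - (α + 1 - δ) = δ - α by ring] at s3
  have k1 : 0 ≤ 2 + 2 * (α + 1) / α := by positivity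
  have k2 : 0 ≤ 2 + (2 * (α + 1) + 1) / α := by positivity
  have k3 : 0 ≤ 2 + (2 * (α + 1 - δ) + 1) / (α - δ) := by
    have : 0 ≤ (2 * (α + 1 - δ) + 1) / (α - δ) := div_nonneg (by linarith) (by linarith)
    linarith
  generalize 2 + 2 * (α + 1) / α = κ1 at s1 k1 ⊢
  generalize 2 + (2 * (α + 1) + 1) / α = κ2 at s2 k2 ⊢
  generalize 2 + (2 * (α + 1 - δ) + 1) / (α - δ) = κ3 at s3 k3 ⊢
  have hRa : 0 ≤ R ^ (-(α + 1)) := Real.rpow_nonneg hR0.le _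
  have hRb : 0 ≤ R ^ (-(α + 1 - δ)) := Real.rpow_nonneg hR0.le _
  have w1 : R ^ (-(α + 1)) * (y ^ (-α) + y ^ (-α - δ)) ≤ 2 * E := by
    rw [mul_add, hRy, hRy]
    have := hle (-(α + 1) - -α / 2) (by linarith)
    have := hle (-(α + 1) - (-α - δ) / 2) (by linarith)
    linarith
  have w2 : R ^ (-(α + 1 - δ)) * (y ^ (δ - α) + y ^ (δ - α - δ)) ≤ 2 * E := by
    rw [mul_add, hRy, hRy]
    have := hle (-(α + 1 - δ) - (δ - α) / 2) (by linarith)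
    have := hle (-(α + 1 - δ) - (δ - α - δ) / 2) (by linarith)
    linarith
  have w3 : y ^ (α + 2 - 2 * δ) ≤ E := by
    rw [hypow]; exact hle _ (by linarith)
  have t1 : |R ^ (-(α + 1)) / (α + 1) * S1 -
      (1 / (α * (α + 1)) * R ^ (-(α / 2 + 1)) - 1 / (α * (α + 1)) * R ^ (-(2 * α + 1)))| ≤
      2 * κ1 * ε * E := by
    have e : R ^ (-(α + 1)) / (α + 1) * S1 -
      (1 / (α * (α + 1)) * R ^ (-(α / 2 + 1)) - 1 / (α * (α + 1)) * R ^ (-(2 * α + 1))) =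
        R ^ (-(α + 1)) / (α + 1) * (S1 - (y ^ (-α) - R ^ (-α)) / α) := by
      have e1 : R ^ (-(α / 2 + 1)) = R ^ (-(α + 1)) * y ^ (-α) := by
        rw [hRy]; congr 1; ring
      have e2 : R ^ (-(2 * α + 1)) = R ^ (-(α + 1)) * R ^ (-α) := by
        rw [← Real.rpow_add hR0]; congr 1; ring
      rw [e1, e2]; field_simp
    rw [e, abs_mul, abs_of_nonneg (div_nonneg hRa (by linarith))]
    calc R ^ (-(α + 1)) / (α + 1) * |S1 - (y ^ (-α) - R ^ (-α)) / α|
        ≤ R ^ (-(α + 1)) * (κ1 * ε * (y ^ (-α) + y ^ (-α - δ))) :=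
          mul_le_mul (div_le_self hRa (by linarith)) s1 (abs_nonneg _) hRa
      _ = κ1 * ε * (R ^ (-(α + 1)) * (y ^ (-α) + y ^ (-α - δ))) := by ring
      _ ≤ κ1 * ε * (2 * E) := by gcongr
      _ = _ := by ring
  have t2 : R ^ (-(α + 1)) * S1 ≤ 2 * κ2 * E := by
    calc R ^ (-(α + 1)) * S1 ≤ R ^ (-(α + 1)) * (κ2 * (y ^ (-α) + y ^ (-α - δ))) := by gcongr
      _ = κ2 * (R ^ (-(α + 1)) * (y ^ (-α) + y ^ (-α - δ))) := by ring
      _ ≤ κ2 * (2 * E) := by gcongr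
      _ = _ := by ring
  have t3 : R ^ (-(α + 1 - δ)) * S2 ≤ 2 * κ3 * E := by
    calc R ^ (-(α + 1 - δ)) * S2
        ≤ R ^ (-(α + 1 - δ)) * (κ3 * (y ^ (δ - α) + y ^ (δ - α - δ))) := by gcongr
      _ = κ3 * (R ^ (-(α + 1 - δ)) * (y ^ (δ - α) + y ^ (δ - α - δ))) := by ring
      _ ≤ κ3 * (2 * E) := by gcongr
      _ = _ := by ring
  have t4 := mul_le_mul_of_nonneg_left (add_le_add t2 t3) (by linarith : 0 ≤ 2 * ε)
  have t5 := mul_le_mul_of_nonneg_left w3 (by linarith : 0 ≤ 24 * ε)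
  have t6 : y ^ (α + 2) / ((α + 1) * (α + 2)) = 1 / ((α + 1) * (α + 2)) * R ^ (-(α / 2 + 1)) := by
    rw [hypow, show -((α + 2) / 2) = -(α / 2 + 1) by ring]; ring
  rw [t6] at p1
  rw [hsplit]
  rw [abs_le] at p1 p2 t1 ⊢
  constructor <;> linarith

end NearUniform
end TripleSumMain

section TripleSumTotal

namespace NearUniform

/-- Evaluation of the weighted triple sum over a nearly uniform family. -/
lemma exists_abs_tripleSum_sub_le (ι : Type*) {α δ : ℝ} (hδ : 0 ≤ δ) (hδα : δ < α) :
    ∃ K : ℝ, ∀ (I : Finset ι) (w l : ι → ℝ) (B ε : ℝ), NearUniform I w l B ε δ → 1 ≤ B →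
      (∀ i ∈ I, w i ≤ B) → B ^ (-(3 * α / 2)) ≤ ε →
      |tripleSum I w l α - 1 / (3 * α ^ 2)| ≤ K * ε := by
  have hα : 0 < α := by linarith
  obtain ⟨A, hA⟩ : ∃ A, A = 1 / ((α + 1) * (α + 2)) + 1 / (α * (α + 1)) := ⟨_, rfl⟩
  obtain ⟨D, hD⟩ : ∃ D, D = 1 / (α * (α + 1)) := ⟨_, rfl⟩
  obtain ⟨c, hc⟩ : ∃ c, c = 1 / ((α + 1) * (α + 2)) := ⟨_, rfl⟩
  have hA0 : 0 ≤ A := by rw [hA]; positivity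
  have hD0 : 0 ≤ D := by rw [hD]; positivity
  have hc0 : 0 ≤ c := by rw [hc]; positivity
  obtain ⟨κ, hκ⟩ : ∃ κ, κ = 24 + 2 * (2 + 2 * (α + 1) / α) + 4 * (2 + (2 * (α + 1) + 1) / α) +
        4 * (2 + (2 * (α + 1 - δ) + 1) / (α - δ)) := ⟨_, rfl⟩
  have hκ0 : 0 ≤ κ := by
    have : 0 ≤ (2 * (α + 1 - δ) + 1) / (α - δ) := div_nonneg (by linarith) (by linarith)
    have : 0 ≤ 2 * (α + 1) / α := by positivity
    have : 0 ≤ (2 * (α + 1) + 1) / α := by positivity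
    rw [hκ]; linarith
  obtain ⟨κa, hκa⟩ : ∃ κ, κ = 2 + 2 * (3 * α / 2 + 1) / (3 * α / 2 + 1 - 1) := ⟨_, rfl⟩
  obtain ⟨κb, hκb⟩ : ∃ κ, κ = 2 + 2 * (3 * α + 1) / (3 * α + 1 - 1) := ⟨_, rfl⟩
  obtain ⟨κc, hκc⟩ : ∃ κ, κ = 2 + (2 * (3 * α / 2 + 1 - δ) + 1) / (3 * α / 2 + 1 - δ - 1) := ⟨_, rfl⟩
  refine ⟨96 + 4 * c + 2 * κ * κc + A * (2 * κa + 1 / (3 * α / 2)) + D * (2 * κb + 1 / (3 * α)), ?_⟩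
  intro I w l B ε H hB hwB hBε
  have hε := H.eps_nonneg
  have hδ1 := H.delta_le_one
  set I1 := I.filter fun r => w r ≤ 1 with hI1
  set I2 := I.filter fun r => ¬ w r ≤ 1 with hI2
  have hI1I : I1 ⊆ I := Finset.filter_subset _ _
  have hI2I : I2 ⊆ I := Finset.filter_subset _ _
  have hI2' : ∀ i ∈ I2, 1 < w i ∧ w i ≤ B := fun i hi =>
    ⟨not_le.mp (Finset.mem_filter.mp hi).2, hwB i (hI2I hi)⟩
  have hI2'' : ∀ i ∈ I, 1 < w i → w i < B → i ∈ I2 := fun i hi h _ =>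
    Finset.mem_filter.mpr ⟨hi, not_le.mpr h⟩
  have hsplit : tripleSum I w l α = ∑ r ∈ I1, l r * (w r ^ (-α) * midSum I w l α r) +
      ∑ r ∈ I2, l r * (w r ^ (-α) * midSum I w l α r) :=
    (Finset.sum_filter_add_sum_filter_not _ _ _).symm
  have hW1 : errWeight δ 1 = 2 := by rw [errWeight, Real.one_rpow]; norm_num
  set S := ∑ r ∈ I1, l r * w r ^ (2 : ℝ) with hS
  set S' := ∑ r ∈ I1, l r * w r ^ (2 - 2 * δ) with hS'
  set Sa := ∑ r ∈ I2, l r * w r ^ (-(3 * α / 2 + 1)) with hSa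
  set Sb := ∑ r ∈ I2, l r * w r ^ (-(3 * α + 1)) with hSb
  set Sc := ∑ r ∈ I2, l r * w r ^ (-(3 * α / 2 + 1 - δ)) with hSc
  have p1 : |∑ r ∈ I1, l r * (w r ^ (-α) * midSum I w l α r) - c * S| ≤ 24 * ε * S' := by
    rw [hS, hS', Finset.mul_sum, Finset.mul_sum, ← Finset.sum_sub_distrib]
    refine (Finset.abs_sum_le_sum_abs _ _).trans (Finset.sum_le_sum fun r hr => ?_)
    have hr0 := H.pos r (hI1I hr)
    have hl := H.nonneg r (hI1I hr)
    have hra : 0 ≤ w r ^ (-α) := Real.rpow_nonneg hr0.le _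
    have h := H.abs_midSum_sub_le_of_le_one hα (hI1I hr) (hwB r (hI1I hr)) (Finset.mem_filter.mp hr).2
    have e1 : w r ^ (2 : ℝ) = w r ^ (-α) * w r ^ (α + 2) := by
      rw [← Real.rpow_add hr0]; congr 1; ring
    have e2 : w r ^ (2 - 2 * δ) = w r ^ (-α) * w r ^ (α + 2 - 2 * δ) := by
      rw [← Real.rpow_add hr0]; congr 1; ring
    have e3 : l r * (w r ^ (-α) * midSum I w l α r) - c * (l r * w r ^ (2 : ℝ)) =
        (l r * w r ^ (-α)) * (midSum I w l α r - w r ^ (α + 2) / ((α + 1) * (α + 2))) := by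
      rw [e1, hc]; ring
    rw [e3, abs_mul, abs_of_nonneg (mul_nonneg hl hra), e2]
    exact (mul_le_mul_of_nonneg_left h (mul_nonneg hl hra)).trans (le_of_eq (by ring))
  have p2 : |∑ r ∈ I2, l r * (w r ^ (-α) * midSum I w l α r) - (A * Sa - D * Sb)| ≤ κ * ε * Sc := by
    rw [hSa, hSb, hSc, Finset.mul_sum, Finset.mul_sum, Finset.mul_sum, ← Finset.sum_sub_distrib,
      ← Finset.sum_sub_distrib]
    refine (Finset.abs_sum_le_sum_abs _ _).trans (Finset.sum_le_sum fun r hr => ?_)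
    have hr0 := H.pos r (hI2I hr)
    have hl := H.nonneg r (hI2I hr)
    have hra : 0 ≤ w r ^ (-α) := Real.rpow_nonneg hr0.le _
    have h := H.abs_midSum_sub_le_of_one_lt hδα (hI2I hr) (hwB r (hI2I hr)) (hI2' r hr).1
    rw [← hA, ← hD, ← hκ] at h
    have e1 : w r ^ (-(3 * α / 2 + 1)) = w r ^ (-α) * w r ^ (-(α / 2 + 1)) := by
      rw [← Real.rpow_add hr0]; congr 1; ring
    have e2 : w r ^ (-(3 * α + 1)) = w r ^ (-α) * w r ^ (-(2 * α + 1)) := by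
      rw [← Real.rpow_add hr0]; congr 1; ring
    have e4 : w r ^ (-(3 * α / 2 + 1 - δ)) = w r ^ (-α) * w r ^ (-(α / 2 + 1 - δ)) := by
      rw [← Real.rpow_add hr0]; congr 1; ring
    have e3 : l r * (w r ^ (-α) * midSum I w l α r) - (A * (l r * w r ^ (-(3 * α / 2 + 1))) -
        D * (l r * w r ^ (-(3 * α + 1)))) = (l r * w r ^ (-α)) * (midSum I w l α r -
          (A * w r ^ (-(α / 2 + 1)) - D * w r ^ (-(2 * α + 1)))) := by
      rw [e1, e2]; ring
    rw [e3, abs_mul, abs_of_nonneg (mul_nonneg hl hra), e4]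
    exact (mul_le_mul_of_nonneg_left h (mul_nonneg hl hra)).trans (le_of_eq (by ring))
  have q1 := H.abs_sum_rpow_sub_le (γ := 2) one_pos hB two_pos hI1I
    (fun i hi => (Finset.mem_filter.mp hi).2) (fun i hi h => Finset.mem_filter.mpr ⟨hi, h.le⟩)
  have q2 := H.sum_rpow_le (γ := 2 - 2 * δ) one_pos hB (by linarith) hI1I
    (fun i hi => (Finset.mem_filter.mp hi).2)
  have q3 := H.abs_sum_rpow_neg_sub_le (s := 3 * α / 2 + 1) one_pos hB le_rfl (by linarith) hI2I hI2' hI2''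
  have q4 := H.abs_sum_rpow_neg_sub_le (s := 3 * α + 1) one_pos hB le_rfl (by linarith) hI2I hI2' hI2''
  have q5 := H.sum_rpow_neg_le (s := 3 * α / 2 + 1 - δ) one_pos hB le_rfl (by linarith) hI2I hI2'
  rw [← hS, hW1, Real.one_rpow, Real.one_rpow] at q1
  rw [← hS', hW1, Real.one_rpow] at q2
  rw [← hSa, hW1, Real.one_rpow, Real.one_rpow, ← hκa] at q3
  rw [← hSb, hW1, Real.one_rpow, Real.one_rpow, ← hκb] at q4
  rw [← hSc, hW1, Real.one_rpow, ← hκc] at q5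
  rw [show 1 - (3 * α / 2 + 1) = -(3 * α / 2) by ring, show 3 * α / 2 + 1 - 1 = 3 * α / 2 by ring] at q3
  rw [show 1 - (3 * α + 1) = -(3 * α) by ring, show 3 * α + 1 - 1 = 3 * α by ring] at q4
  have hB0 : 0 < B := by linarith
  have hBb : B ^ (-(3 * α)) ≤ ε :=
    (Real.rpow_le_rpow_of_exponent_le hB (by linarith)).trans hBε
  have hBa0 : 0 ≤ B ^ (-(3 * α / 2)) := Real.rpow_nonneg hB0.le _
  have hBb0 : 0 ≤ B ^ (-(3 * α)) := Real.rpow_nonneg hB0.le _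
  have r3 : |Sa - 1 / (3 * α / 2)| ≤ (2 * κa + 1 / (3 * α / 2)) * ε := by
    have h : |(1 - B ^ (-(3 * α / 2))) / (3 * α / 2) - 1 / (3 * α / 2)| ≤ 1 / (3 * α / 2) * ε := by
      rw [← sub_div, sub_sub_cancel_left, abs_div, abs_neg, abs_of_nonneg hBa0,
        abs_of_pos (by positivity), div_eq_mul_one_div, mul_comm]
      gcongr
    have := (abs_sub_le _ _ _).trans (add_le_add q3 h)
    linarith
  have r4 : |Sb - 1 / (3 * α)| ≤ (2 * κb + 1 / (3 * α)) * ε := by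
    have h : |(1 - B ^ (-(3 * α))) / (3 * α) - 1 / (3 * α)| ≤ 1 / (3 * α) * ε := by
      rw [← sub_div, sub_sub_cancel_left, abs_div, abs_neg, abs_of_nonneg hBb0,
        abs_of_pos (by positivity), div_eq_mul_one_div, mul_comm]
      gcongr
    have := (abs_sub_le _ _ _).trans (add_le_add q4 h)
    linarith
  have hmain : 1 / (3 * α ^ 2) = c * (1 / (2 + 1)) + (A * (1 / (3 * α / 2)) - D * (1 / (3 * α))) := by
    rw [hc, hA, hD]; field_simp; ring
  have m1 : |c * S - c * (1 / (2 + 1))| ≤ c * (4 * ε) := by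
    rw [← mul_sub, abs_mul, abs_of_nonneg hc0]
    exact mul_le_mul_of_nonneg_left (by linarith) hc0
  have m3 : |A * Sa - A * (1 / (3 * α / 2))| ≤ A * ((2 * κa + 1 / (3 * α / 2)) * ε) := by
    rw [← mul_sub, abs_mul, abs_of_nonneg hA0]
    exact mul_le_mul_of_nonneg_left r3 hA0
  have m4 : |D * Sb - D * (1 / (3 * α))| ≤ D * ((2 * κb + 1 / (3 * α)) * ε) := by
    rw [← mul_sub, abs_mul, abs_of_nonneg hD0]
    exact mul_le_mul_of_nonneg_left r4 hD0
  have n2 := mul_le_mul_of_nonneg_left q2 (by linarith : 0 ≤ 24 * ε)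
  have n5 := mul_le_mul_of_nonneg_left q5 (mul_nonneg hκ0 hε)
  rw [hsplit, hmain]
  rw [abs_le] at p1 p2 m1 m3 m4 ⊢
  constructor <;> linarith

end NearUniform
end TripleSumTotal

section PrimeTriples
open Topology

lemma NearUniform.of_le {ι : Type*} {I : Finset ι} {w l : ι → ℝ} {B ε δ : ℝ}
    (hpos : ∀ i ∈ I, 0 < w i) (hnonneg : ∀ i ∈ I, 0 ≤ l i)
    (hle : ∀ u, 0 < u → u ≤ B → |∑ i ∈ I with w i ≤ u, l i - u| ≤ ε * errWeight δ u)
    (hε0 : 0 ≤ ε) (hε1 : ε ≤ 1) (hδ0 : 0 ≤ δ) (hδ1 : δ ≤ 1) : NearUniform I w l B ε δ := by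
  refine ⟨hpos, hnonneg, hle, fun u hu huB => ?_, hε0, hε1, hδ0, hδ1⟩
  have hev : ∀ᶠ t in 𝓝[<] u, ∀ i ∈ I, w i < u → w i ≤ t := by
    rw [Filter.eventually_all_finset]
    intro i _
    by_cases h : w i < u
    · filter_upwards [Ioo_mem_nhdsLT h] with t ht _ using ht.1.le
    · exact Filter.Eventually.of_forall fun t h' => absurd h' h
  have hc1 : Tendsto (fun t : ℝ => |∑ i ∈ I with w i < u, l i - t|) (𝓝[<] u)
      (𝓝 |∑ i ∈ I with w i < u, l i - u|) :=
    ((continuous_const.sub continuous_id).abs.tendsto u).mono_left nhdsWithin_le_nhds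
  have hc2 : Tendsto (fun t : ℝ => ε * errWeight δ t) (𝓝[<] u) (𝓝 (ε * errWeight δ u)) := by
    refine Tendsto.mono_left ?_ nhdsWithin_le_nhds
    refine ((tendsto_id).add ?_).const_mul ε
    exact (Real.continuousAt_rpow_const u (1 - δ) (Or.inl hu.ne')).tendsto
  refine le_of_tendsto_of_tendsto hc1 hc2 ?_
  filter_upwards [hev, Ioo_mem_nhdsLT hu] with t ht htu
  have e : I.filter (fun i => w i < u) = I.filter (fun i => w i ≤ t) := by
    ext i; simp only [Finset.mem_filter]
    exact ⟨fun h => ⟨h.1, ht i h.1 h.2⟩, fun h => ⟨h.1, h.2.trans_lt htu.2⟩⟩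
  rw [e]
  exact hle t htu.1 (htu.2.le.trans huB)

/-- Chebyshev's function is close to the identity, uniformly relative to a scale `z`. -/
lemma exists_abs_theta_sub_mul_log_le {δ : ℝ} (hδ : 0 < δ) (hδ1 : δ ≤ 1) :
    ∃ C : ℝ, 0 < C ∧ ∀ z u : ℝ, 0 < z → 0 < u →
      |Chebyshev.theta u - u| * Real.log z ≤ C * (u + z ^ δ * u ^ (1 - δ)) := by
  obtain ⟨C, hC, hθ⟩ := exists_abs_theta_sub_le
  refine ⟨max C 1 / δ, by positivity, fun z u hz hu => ?_⟩
  set ρ := (z / u) ^ δ with hρ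
  have hρ0 : 0 < ρ := Real.rpow_pos_of_pos (div_pos hz hu) _
  have hW : u + z ^ δ * u ^ (1 - δ) = u * (1 + ρ) := by
    rw [hρ, Real.div_rpow hz.le hu.le, Real.rpow_sub hu, Real.rpow_one]; ring
  have hlog : Real.log z ≤ ρ / δ + Real.log u := by
    have h1 : δ * (Real.log z - Real.log u) ≤ ρ := by
      rw [hρ, Real.rpow_def_of_pos (div_pos hz hu), Real.log_div hz.ne' hu.ne']
      have := Real.add_one_le_exp ((Real.log z - Real.log u) * δ)
      linarith
    have : Real.log z - Real.log u ≤ ρ / δ := by rw [le_div_iff₀ hδ]; linarith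
    linarith
  have hδi : 1 ≤ 1 / δ := by rw [le_div_iff₀ hδ]; linarith
  have hM : C ≤ max C 1 := le_max_left _ _
  have hM1 : 1 ≤ max C 1 := le_max_right _ _
  rw [hW]
  rcases lt_or_ge u 1 with h | h
  · rw [Chebyshev.theta_eq_zero_of_lt_two (by linarith), zero_sub, abs_neg, abs_of_pos hu]
    have hlu := Real.log_nonpos hu.le h.le
    calc u * Real.log z ≤ u * (1 / δ * (1 + ρ)) := by
          refine mul_le_mul_of_nonneg_left ?_ hu.le
          have : ρ / δ = 1 / δ * ρ := by ring
          nlinarith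
      _ = 1 / δ * (u * (1 + ρ)) := by ring
      _ ≤ _ := by gcongr
  · have hlu := Real.log_nonneg h
    have h1 := hθ u h
    have h2 : Real.log z ≤ (1 + Real.log u) * (1 / δ * (1 + ρ)) := by
      have h3 : ρ / δ = 1 / δ * ρ := by ring
      have h4 : 0 ≤ Real.log u * (1 / δ * ρ) := by positivity
      have h5 : Real.log u ≤ Real.log u * (1 / δ) := le_mul_of_one_le_right hlu hδi
      nlinarith
    calc |Chebyshev.theta u - u| * Real.log z
        ≤ |Chebyshev.theta u - u| * ((1 + Real.log u) * (1 / δ * (1 + ρ))) := by gcongr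
      _ = |Chebyshev.theta u - u| * (1 + Real.log u) * (1 / δ * (1 + ρ)) := by ring
      _ ≤ C * u * (1 / δ * (1 + ρ)) := by gcongr
      _ ≤ max C 1 * u * (1 / δ * (1 + ρ)) := by gcongr
      _ = _ := by ring

/-- The primes up to `x`. -/
noncomputable def primesUpTo (x : ℝ) : Finset ℕ := (Finset.Icc 1 ⌊x⌋₊).filter Nat.Prime

lemma mem_primesUpTo {x : ℝ} {p : ℕ} : p ∈ primesUpTo x ↔ p.Prime ∧ (p : ℝ) ≤ x := by
  rw [primesUpTo, Finset.mem_filter, Finset.mem_Icc]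
  constructor
  · rintro ⟨⟨h1, h2⟩, h3⟩
    exact ⟨h3, (Nat.le_floor_iff' (by lia)).mp h2⟩
  · rintro ⟨h1, h2⟩
    exact ⟨⟨h1.one_lt.le, (Nat.le_floor_iff' h1.ne_zero).mpr h2⟩, h1⟩

lemma sum_log_primesUpTo (u : ℝ) : ∑ p ∈ primesUpTo u, Real.log p = Chebyshev.theta u := by
  rw [Chebyshev.theta]
  rfl

/-- The logarithmically weighted sum over prime triples. -/
noncomputable def logTripleSum (α x : ℝ) : ℝ :=
  ∑ r ∈ primesUpTo x, ∑ q ∈ primesUpTo x with q < r,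
    ∑ p ∈ primesUpTo x with p < q ∧ (p : ℝ) * q * r ≤ x,
      Real.log p * Real.log q * Real.log r * ((p : ℝ) / r) ^ α

lemma tripleSum_primesUpTo {α x z : ℝ} (hz : 0 < z) (hzx : z ^ 3 = x) :
    NearUniform.tripleSum (primesUpTo x) (fun p => (p : ℝ) / z) (fun p => Real.log p / z) α =
      logTripleSum α x / x := by
  simp only [NearUniform.tripleSum, NearUniform.midSum, NearUniform.innerSum, logTripleSum]
  rw [Finset.sum_div]
  refine Finset.sum_congr rfl fun r hr => ?_
  have hr0 : (0 : ℝ) < r := by exact_mod_cast (mem_primesUpTo.mp hr).1.pos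
  rw [Finset.mul_sum, Finset.mul_sum, Finset.sum_div]
  have e1 : ∀ a b : ℕ, ((a : ℝ) / z < (b : ℝ) / z ↔ a < b) := fun a b => by
    rw [div_lt_div_iff_of_pos_right hz]; exact_mod_cast Iff.rfl
  refine Finset.sum_congr (Finset.filter_congr fun q _ => e1 _ _) fun q hq => ?_
  rw [Finset.mul_sum, Finset.mul_sum, Finset.mul_sum, Finset.sum_div]
  refine Finset.sum_congr (Finset.filter_congr fun p _ => and_congr (e1 _ _) ?_) fun p hp => ?_
  · have : (p : ℝ) / z * (q / z) * (r / z) = (p * q * r) / x := by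
      rw [← hzx]; field_simp
    rw [this, div_le_one (by rw [← hzx]; positivity)]
  · have : ((r : ℝ) / z) ^ (-α) * ((p : ℝ) / z) ^ α = ((p : ℝ) / r) ^ α := by
      rw [Real.rpow_neg (by positivity), ← Real.inv_rpow (by positivity),
        ← Real.mul_rpow (by positivity) (by positivity)]
      congr 1; field_simp
    rw [← this, ← hzx]; field_simp

/-- The logarithmically weighted prime triple sum is `x / (3 α²) + O(x / log x)`. -/
lemma exists_abs_logTripleSum_sub_le {α : ℝ} (hα : 0 < α) :
    ∃ K x₀ : ℝ, 1 < x₀ ∧ ∀ x, x₀ ≤ x →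
      |logTripleSum α x - x / (3 * α ^ 2)| ≤ K * x / Real.log x := by
  set δ := min α 1 / 2 with hδ
  have hm : 0 < min α 1 := lt_min hα one_pos
  have hδ0 : 0 < δ := by positivity
  have hδ1 : δ ≤ 1 := by have := min_le_right α 1; rw [hδ]; linarith
  have hδα : δ < α := by have := min_le_left α 1; rw [hδ]; linarith
  obtain ⟨C, hC, hθ⟩ := exists_abs_theta_sub_mul_log_le hδ0 hδ1
  obtain ⟨K, hK⟩ := NearUniform.exists_abs_tripleSum_sub_le ℕ hδ0.le hδα
  obtain ⟨M, hM⟩ : ∃ M, M = 3 * C + 1 / α := ⟨_, rfl⟩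
  have hM0 : 0 < M := by rw [hM]; positivity
  refine ⟨K * M, Real.exp M, Real.one_lt_exp_iff.mpr hM0, fun x hx => ?_⟩
  have hx0 : 0 < x := (Real.exp_pos _).trans_le hx
  have hL : M ≤ Real.log x := (Real.le_log_iff_exp_le hx0).mpr hx
  have hL0 : 0 < Real.log x := hM0.trans_le hL
  have hx1 : 1 ≤ x := (Real.one_le_exp hM0.le).trans hx
  set z := x ^ (1 / 3 : ℝ) with hz
  have hz0 : 0 < z := Real.rpow_pos_of_pos hx0 _
  have hz1 : 1 ≤ z := Real.one_le_rpow hx1 (by norm_num)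
  have hz3 : z ^ 3 = x := by
    rw [hz, ← Real.rpow_natCast, ← Real.rpow_mul hx0.le]; norm_num
  have hzlog : Real.log z = Real.log x / 3 := by
    rw [hz, Real.log_rpow hx0]; ring
  have hH : NearUniform (primesUpTo x) (fun p => (p : ℝ) / z) (fun p => Real.log p / z) (z ^ 2)
      (M / Real.log x) δ := by
    refine NearUniform.of_le ?_ ?_ ?_ (by positivity) ((div_le_one hL0).mpr hL) hδ0.le hδ1
    · intro p hp
      have : (0 : ℝ) < p := by exact_mod_cast (mem_primesUpTo.mp hp).1.pos
      positivity
    · intro p hp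
      exact div_nonneg (Real.log_natCast_nonneg p) hz0.le
    · intro u hu huB
      have e : ∑ p ∈ (primesUpTo x).filter (fun p : ℕ => (p : ℝ) / z ≤ u), Real.log p / z =
          Chebyshev.theta (z * u) / z := by
        rw [← sum_log_primesUpTo, Finset.sum_div]
        refine Finset.sum_congr ?_ fun _ _ => rfl
        ext p
        rw [Finset.mem_filter, mem_primesUpTo, mem_primesUpTo, div_le_iff₀ hz0, mul_comm u z]
        have : z * u ≤ x := by
          calc z * u ≤ z * z ^ 2 := by gcongr
            _ = x := by rw [← hz3]; ring
        constructor
        · rintro ⟨⟨h1, h2⟩, h3⟩; exact ⟨h1, h3⟩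
        · rintro ⟨h1, h3⟩; exact ⟨⟨h1, h3.trans this⟩, h3⟩
      rw [e]
      have h := hθ z (z * u) hz0 (by positivity)
      have e2 : z * u + z ^ δ * (z * u) ^ (1 - δ) = z * errWeight δ u := by
        rw [Real.mul_rpow hz0.le hu.le, ← mul_assoc, ← Real.rpow_add hz0, add_sub_cancel, Real.rpow_one,
          errWeight]; ring
      have e3 : |Chebyshev.theta (z * u) / z - u| = |Chebyshev.theta (z * u) - z * u| / z := by
        rw [← abs_of_pos hz0, ← abs_div, abs_of_pos hz0]; congr 1; field_simp
      rw [e2, hzlog] at h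
      rw [e3, div_le_iff₀ hz0, div_mul_eq_mul_div, div_mul_eq_mul_div, le_div_iff₀ hL0]
      have hW := errWeight_nonneg (δ := δ) hu.le
      have : 0 ≤ 1 / α * errWeight δ u * z := by positivity
      rw [hM]
      linarith
  have hB1 : (1 : ℝ) ≤ z ^ 2 := one_le_pow₀ hz1
  have hwB : ∀ p ∈ primesUpTo x, (p : ℝ) / z ≤ z ^ 2 := fun p hp => by
    rw [div_le_iff₀ hz0]
    calc (p : ℝ) ≤ x := (mem_primesUpTo.mp hp).2
      _ = _ := by rw [← hz3]; ring
  have hBε : (z ^ 2) ^ (-(3 * α / 2)) ≤ M / Real.log x := by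
    have e1 : (z ^ 2) ^ (-(3 * α / 2)) = x ^ (-α) := by
      rw [hz, ← Real.rpow_natCast, ← Real.rpow_mul hx0.le, ← Real.rpow_mul hx0.le]
      congr 1; push_cast; ring
    rw [e1, Real.rpow_neg hx0.le, inv_le_comm₀ (by positivity) (by positivity), inv_div,
      div_le_iff₀ hM0]
    have h1 : Real.log x * α ≤ x ^ α := by
      rw [Real.rpow_def_of_pos hx0]
      have := Real.add_one_le_exp (Real.log x * α)
      linarith
    calc Real.log x = Real.log x * α * (1 / α) := by field_simp
      _ ≤ x ^ α * M := by
        have : 1 / α ≤ M := by rw [hM]; linarith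
        gcongr
  have h := hK _ _ _ _ _ hH hB1 hwB hBε
  rw [tripleSum_primesUpTo hz0 hz3] at h
  have e : logTripleSum α x - x / (3 * α ^ 2) = x * (logTripleSum α x / x - 1 / (3 * α ^ 2)) := by
    field_simp
  rw [e, abs_mul, abs_of_pos hx0]
  calc _ ≤ x * (K * (M / Real.log x)) := mul_le_mul_of_nonneg_left h hx0.le
    _ = _ := by ring

end PrimeTriples

section RemovingLogarithms

/-- Triples `(r, q, p)` of primes with `p < q < r` and `p * q * r ≤ x`. -/
noncomputable def primeTriples (x : ℝ) : Finset (ℕ × ℕ × ℕ) :=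
  (primesUpTo x ×ˢ primesUpTo x ×ˢ primesUpTo x).filter fun t =>
    t.2.1 < t.1 ∧ t.2.2 < t.2.1 ∧ (t.2.2 : ℝ) * t.2.1 * t.1 ≤ x

lemma mem_primeTriples {x : ℝ} {t : ℕ × ℕ × ℕ} :
    t ∈ primeTriples x ↔ t.1.Prime ∧ t.2.1.Prime ∧ t.2.2.Prime ∧ t.2.1 < t.1 ∧ t.2.2 < t.2.1 ∧
      (t.2.2 : ℝ) * t.2.1 * t.1 ≤ x := by
  simp only [primeTriples, Finset.mem_filter, Finset.mem_product, mem_primesUpTo]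
  constructor
  · rintro ⟨⟨h1, h2, h3⟩, h4⟩; exact ⟨h1.1, h2.1, h3.1, h4⟩
  · rintro ⟨h1, h2, h3, h4, h5, h6⟩
    have a1 : (1 : ℝ) ≤ t.1 := by exact_mod_cast h1.one_lt.le
    have a2 : (1 : ℝ) ≤ t.2.1 := by exact_mod_cast h2.one_lt.le
    have a3 : (1 : ℝ) ≤ t.2.2 := by exact_mod_cast h3.one_lt.le
    have a4 : (t.2.1 : ℝ) ≤ t.1 := by exact_mod_cast h4.le
    have a5 : (t.2.2 : ℝ) ≤ t.2.1 := by exact_mod_cast h5.le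
    have : (1 : ℝ) * 1 * t.1 ≤ (t.2.2 : ℝ) * t.2.1 * t.1 := by gcongr
    exact ⟨⟨⟨h1, by linarith⟩, ⟨h2, by linarith⟩, ⟨h3, by linarith⟩⟩, h4, h5, h6⟩

/-- The product of the logarithms of the members of a triple. -/
noncomputable def logWeight (t : ℕ × ℕ × ℕ) : ℝ :=
  Real.log t.2.2 * Real.log t.2.1 * Real.log t.1

/-- The quotient of the last by the first entry of a triple. -/
noncomputable def ratio (t : ℕ × ℕ × ℕ) : ℝ := (t.2.2 : ℝ) / t.1

lemma logWeight_nonneg (t : ℕ × ℕ × ℕ) : 0 ≤ logWeight t :=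
  mul_nonneg (mul_nonneg (Real.log_natCast_nonneg _) (Real.log_natCast_nonneg _))
    (Real.log_natCast_nonneg _)

lemma ratio_nonneg (t : ℕ × ℕ × ℕ) : 0 ≤ ratio t := by unfold ratio; positivity

lemma logTripleSum_eq (α x : ℝ) :
    logTripleSum α x = ∑ t ∈ primeTriples x, logWeight t * ratio t ^ α := by
  rw [logTripleSum, primeTriples, Finset.sum_filter, Finset.sum_product]
  refine Finset.sum_congr rfl fun r _ => ?_
  rw [Finset.sum_product, Finset.sum_filter]
  refine Finset.sum_congr rfl fun q _ => ?_
  rw [Finset.sum_filter]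
  by_cases h : q < r
  · simp only [h, if_true, true_and]
    rfl
  · simp [h]

lemma logTripleSum_mono (α : ℝ) {x y : ℝ} (hxy : x ≤ y) : logTripleSum α x ≤ logTripleSum α y := by
  rw [logTripleSum_eq, logTripleSum_eq]
  refine Finset.sum_le_sum_of_subset_of_nonneg (fun t ht => ?_)
    fun t _ _ => mul_nonneg (logWeight_nonneg t) (Real.rpow_nonneg (ratio_nonneg t) _)
  rw [mem_primeTriples] at ht ⊢
  exact ⟨ht.1, ht.2.1, ht.2.2.1, ht.2.2.2.1, ht.2.2.2.2.1, ht.2.2.2.2.2.trans hxy⟩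

lemma exists_logTripleSum_le {α : ℝ} (hα : 0 < α) :
    ∃ C : ℝ, 0 ≤ C ∧ ∀ x, 0 < x → logTripleSum α x ≤ C * x := by
  obtain ⟨K, x₀, hx₀, h⟩ := exists_abs_logTripleSum_sub_le hα
  have hL : 0 < Real.log x₀ := Real.log_pos hx₀
  have hT : 0 ≤ logTripleSum α x₀ := by
    rw [logTripleSum_eq]
    exact Finset.sum_nonneg fun t _ =>
      mul_nonneg (logWeight_nonneg t) (Real.rpow_nonneg (ratio_nonneg t) _)
  refine ⟨logTripleSum α x₀ + 1 / (3 * α ^ 2) + |K| / Real.log x₀, by positivity, fun x hx => ?_⟩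
  have e1 : 0 ≤ 1 / (3 * α ^ 2) * x := by positivity
  have e2 : 0 ≤ |K| / Real.log x₀ * x := by positivity
  have e3 : 0 ≤ logTripleSum α x₀ * x := by positivity
  rcases lt_or_ge x 1 with h1 | h1
  · have : logTripleSum α x = 0 := by
      rw [logTripleSum_eq]
      refine Finset.sum_eq_zero fun t ht => ?_
      rw [mem_primeTriples] at ht
      have a1 : (1 : ℝ) ≤ t.1 := by exact_mod_cast ht.1.one_lt.le
      have a2 : (1 : ℝ) ≤ t.2.1 := by exact_mod_cast ht.2.1.one_lt.le
      have a3 : (1 : ℝ) ≤ t.2.2 := by exact_mod_cast ht.2.2.1.one_lt.le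
      have : (1 : ℝ) * 1 * 1 ≤ (t.2.2 : ℝ) * t.2.1 * t.1 := by gcongr
      linarith [ht.2.2.2.2.2]
    rw [this]; linarith
  · rcases le_or_gt x x₀ with h2 | h2
    · have := logTripleSum_mono α h2
      nlinarith
    · have h3 := (abs_le.mp (h x h2.le)).2
      have h4 : K * x / Real.log x ≤ |K| / Real.log x₀ * x := by
        rw [div_mul_eq_mul_div]
        have := Real.log_le_log (by linarith) h2.le
        have := le_abs_self K
        gcongr
      have h5 : x / (3 * α ^ 2) = 1 / (3 * α ^ 2) * x := by ring
      linarith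

lemma rpow_half_le_sum_two_pow {v : ℝ} (hv : 1 ≤ v) {N : ℕ} (hN : v < 4 ^ N) :
    v ^ (1 / 2 : ℝ) ≤ ∑ j ∈ Finset.range N with (4 : ℝ) ^ j ≤ v, (2 : ℝ) ^ (j + 1) := by
  obtain ⟨j, hj, hj'⟩ := exists_nat_pow_near hv (by norm_num : (1 : ℝ) < 4)
  have hjN : j < N := by
    by_contra hcon
    have : (4 : ℝ) ^ N ≤ 4 ^ j := pow_le_pow_right₀ (by norm_num) (by lia)
    linarith
  have hmem : j ∈ (Finset.range N).filter fun j => (4 : ℝ) ^ j ≤ v :=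
    Finset.mem_filter.mpr ⟨Finset.mem_range.mpr hjN, hj⟩
  refine le_trans ?_ (Finset.single_le_sum (f := fun j => (2 : ℝ) ^ (j + 1)) (fun _ _ => by positivity) hmem)
  calc v ^ (1 / 2 : ℝ) ≤ ((4 : ℝ) ^ (j + 1)) ^ (1 / 2 : ℝ) :=
        Real.rpow_le_rpow (by linarith) hj'.le (by norm_num)
    _ = 2 ^ (j + 1) := by
        rw [show (4 : ℝ) ^ (j + 1) = (2 ^ (j + 1)) ^ 2 by rw [← pow_mul, mul_comm, pow_mul]; norm_num,
          ← Real.sqrt_eq_rpow, Real.sqrt_sq (by positivity)]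

/-- A linear bound for the summatory function is stable under the weight `(x / n) ^ (1 / 2)`. -/
lemma sum_logWeight_mul_rpow_half_le {α C : ℝ} (hC : ∀ x, 0 < x → logTripleSum α x ≤ C * x)
    {x : ℝ} (hx : 0 < x) :
    ∑ t ∈ primeTriples x, logWeight t * ratio t ^ α *
      (x / ((t.2.2 : ℝ) * t.2.1 * t.1)) ^ (1 / 2 : ℝ) ≤ 4 * C * x := by
  have hC0 : 0 ≤ C := by
    have h1 := hC 1 one_pos
    have : 0 ≤ logTripleSum α 1 := by
      rw [logTripleSum_eq]
      exact Finset.sum_nonneg fun t _ =>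
        mul_nonneg (logWeight_nonneg t) (Real.rpow_nonneg (ratio_nonneg t) _)
    linarith
  obtain ⟨N, hN⟩ := pow_unbounded_of_one_lt x (by norm_num : (1 : ℝ) < 4)
  have hn : ∀ t ∈ primeTriples x, (1 : ℝ) ≤ (t.2.2 : ℝ) * t.2.1 * t.1 := fun t ht => by
    rw [mem_primeTriples] at ht
    have a1 : (1 : ℝ) ≤ t.1 := by exact_mod_cast ht.1.one_lt.le
    have a2 : (1 : ℝ) ≤ t.2.1 := by exact_mod_cast ht.2.1.one_lt.le
    have a3 : (1 : ℝ) ≤ t.2.2 := by exact_mod_cast ht.2.2.1.one_lt.le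
    calc (1 : ℝ) = 1 * 1 * 1 := by norm_num
      _ ≤ _ := by gcongr
  have hw : ∀ t : ℕ × ℕ × ℕ, 0 ≤ logWeight t * ratio t ^ α := fun t =>
    mul_nonneg (logWeight_nonneg t) (Real.rpow_nonneg (ratio_nonneg t) _)
  calc _ ≤ ∑ t ∈ primeTriples x, logWeight t * ratio t ^ α *
        ∑ j ∈ Finset.range N, (if (t.2.2 : ℝ) * t.2.1 * t.1 ≤ x / 4 ^ j then (2 : ℝ) ^ (j + 1) else 0) := by
        refine Finset.sum_le_sum fun t ht => mul_le_mul_of_nonneg_left ?_ (hw t)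
        have h1 := hn t ht
        have h0 : (0 : ℝ) < (t.2.2 : ℝ) * t.2.1 * t.1 := by linarith
        have h2 : 1 ≤ x / ((t.2.2 : ℝ) * t.2.1 * t.1) := by
          rw [one_le_div h0]; exact (mem_primeTriples.mp ht).2.2.2.2.2
        refine (rpow_half_le_sum_two_pow h2 ((div_le_self hx.le h1).trans_lt hN)).trans (le_of_eq ?_)
        rw [Finset.sum_filter]
        refine Finset.sum_congr rfl fun j _ => if_congr ?_ rfl rfl
        rw [le_div_iff₀ h0, le_div_iff₀ (by positivity), mul_comm]
    _ = ∑ j ∈ Finset.range N, (2 : ℝ) ^ (j + 1) * logTripleSum α (x / 4 ^ j) := by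
        simp_rw [Finset.mul_sum]
        rw [Finset.sum_comm]
        refine Finset.sum_congr rfl fun j _ => ?_
        rw [logTripleSum_eq, Finset.mul_sum]
        have hsub : primeTriples (x / 4 ^ j) =
            (primeTriples x).filter fun t => (t.2.2 : ℝ) * t.2.1 * t.1 ≤ x / 4 ^ j := by
          ext t
          rw [Finset.mem_filter, mem_primeTriples, mem_primeTriples]
          have : x / 4 ^ j ≤ x := div_le_self hx.le (one_le_pow₀ (by norm_num))
          constructor
          · rintro ⟨h1, h2, h3, h4, h5, h6⟩; exact ⟨⟨h1, h2, h3, h4, h5, h6.trans this⟩, h6⟩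
          · rintro ⟨⟨h1, h2, h3, h4, h5, _⟩, h6⟩; exact ⟨h1, h2, h3, h4, h5, h6⟩
        rw [hsub, Finset.sum_filter]
        refine Finset.sum_congr rfl fun t _ => ?_
        split_ifs <;> ring
    _ ≤ ∑ j ∈ Finset.range N, 2 * C * x * (1 / 2 : ℝ) ^ j := by
        refine Finset.sum_le_sum fun j _ => ?_
        have h := hC (x / 4 ^ j) (by positivity)
        calc (2 : ℝ) ^ (j + 1) * logTripleSum α (x / 4 ^ j) ≤ 2 ^ (j + 1) * (C * (x / 4 ^ j)) := by gcongr
          _ = 2 * C * x * (1 / 2 : ℝ) ^ j := by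
              rw [show (4 : ℝ) ^ j = 2 ^ j * 2 ^ j by rw [← mul_pow]; norm_num, pow_succ, div_pow,
                one_pow]
              field_simp
    _ ≤ 2 * C * x * 2 := by
        rw [← Finset.mul_sum]
        exact mul_le_mul_of_nonneg_left (sum_geometric_two_le N) (by positivity)
    _ = _ := by ring

lemma one_add_log_le_rpow {t η : ℝ} (ht : 0 < t) (hη : 0 < η) (hη1 : η ≤ 1) :
    1 + Real.log t ≤ t ^ η / η := by
  rw [le_div_iff₀ hη, Real.rpow_def_of_pos ht]
  have := Real.add_one_le_exp (Real.log t * η)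
  nlinarith

/-- Comparison of `L ^ 3` with `27 a b c` when `a ≤ b ≤ c` are close to `L / 3`. -/
lemma mul_abs_cube_sub_le {a b c L : ℝ} (ha : 1 / 2 ≤ a) (hab : a ≤ b) (hbc : b ≤ c)
    (hL : a + b + c ≤ L) :
    L * |L ^ 3 - 27 * (a * b * c)| ≤
      2058 * (a * b * c) * ((1 + (L - (a + b + c))) ^ 4 * (1 + (c - a)) ^ 4) := by
  obtain ⟨X, hX⟩ : ∃ X, X = 1 + (L - (a + b + c)) := ⟨_, rfl⟩
  obtain ⟨Y, hY⟩ : ∃ Y, Y = 1 + (c - a) := ⟨_, rfl⟩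
  rw [← hX, ← hY]
  have hX1 : 1 ≤ X := by linarith
  have hY1 : 1 ≤ Y := by linarith
  have hXY : X + Y - 1 ≤ X * Y := by nlinarith
  have hXY1 : 1 ≤ X * Y := by nlinarith
  have ha0 : 0 < a := by linarith
  have hb0 : 0 < b := by linarith
  have hc0 : 0 < c := by linarith
  have hL0 : 0 < L := by linarith
  have habc : a ^ 3 ≤ a * b * c := by
    calc a ^ 3 = a * a * a := by ring
      _ ≤ a * b * c := by gcongr; linarith
  have h3a : L - 3 * a ≤ 2 * (X * Y) := by linarith
  have hL7 : L ≤ 7 * a * (X * Y) := by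
    have h1 : 1 * (X * Y) ≤ 2 * a * (X * Y) := by gcongr; linarith
    have h2 : a * 1 ≤ a * (X * Y) := by gcongr
    nlinarith
  have hamgm : 27 * (a * b * c) ≤ L ^ 3 := by
    have h1 : 27 * (a * b * c) ≤ (a + b + c) ^ 3 := by
      nlinarith [mul_nonneg ha0.le (sq_nonneg (b - c)), mul_nonneg hb0.le (sq_nonneg (a - c)),
        mul_nonneg hc0.le (sq_nonneg (a - b)), mul_nonneg (by linarith : 0 ≤ a + b + c)
          (add_nonneg (add_nonneg (sq_nonneg (a - b)) (sq_nonneg (b - c))) (sq_nonneg (a - c)))]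
    exact h1.trans (pow_le_pow_left₀ (by positivity) hL 3)
  rw [abs_of_nonneg (by linarith)]
  have h1 : L ^ 3 - 27 * (a * b * c) ≤ 6 * L ^ 2 * (X * Y) := by
    have h2 : L ^ 3 - (3 * a) ^ 3 ≤ 3 * L ^ 2 * (L - 3 * a) := by
      have h3 : 0 ≤ L - 3 * a := by linarith
      have h4 : 0 ≤ (L - 3 * a) ^ 2 * (2 * L + 3 * a) := by positivity
      nlinarith
    have h5 : 3 * L ^ 2 * (L - 3 * a) ≤ 3 * L ^ 2 * (2 * (X * Y)) := by gcongr
    nlinarith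
  calc L * (L ^ 3 - 27 * (a * b * c)) ≤ L * (6 * L ^ 2 * (X * Y)) := by gcongr
    _ = 6 * L ^ 3 * (X * Y) := by ring
    _ ≤ 6 * (7 * a * (X * Y)) ^ 3 * (X * Y) := by gcongr
    _ = 2058 * a ^ 3 * (X ^ 4 * Y ^ 4) := by ring
    _ ≤ _ := by gcongr

/-- The sum over prime triples, without logarithmic weights. -/
noncomputable def ratioSum (α x : ℝ) : ℝ := ∑ t ∈ primeTriples x, ratio t ^ α

lemma exists_abs_ratioSum_sub_logTripleSum_le {α : ℝ} (hα : 0 < α) :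
    ∃ C : ℝ, ∀ x, 1 < x →
      Real.log x * |Real.log x ^ 3 * ratioSum α x - 27 * logTripleSum α x| ≤ C * x := by
  obtain ⟨η, hη⟩ : ∃ η, η = min (α / 8) 1 := ⟨_, rfl⟩
  have hη0 : 0 < η := by rw [hη]; exact lt_min (by positivity) one_pos
  have hη1 : η ≤ 1 := by rw [hη]; exact min_le_right _ _
  have hηα : η ≤ α / 8 := by rw [hη]; exact min_le_left _ _
  obtain ⟨C, hC0, hC⟩ := exists_logTripleSum_le (α := α - 4 * η) (by linarith)
  refine ⟨2058 * (8 ^ 4 / η ^ 4) * (4 * C), fun x hx => ?_⟩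
  have hx0 : 0 < x := by linarith
  have hL : 0 < Real.log x := Real.log_pos hx
  have hmain := sum_logWeight_mul_rpow_half_le hC hx0
  rw [logTripleSum_eq, ratioSum, Finset.mul_sum, Finset.mul_sum, ← Finset.sum_sub_distrib]
  calc _ ≤ Real.log x * ∑ t ∈ primeTriples x,
        |Real.log x ^ 3 * ratio t ^ α - 27 * (logWeight t * ratio t ^ α)| := by
        gcongr
        exact Finset.abs_sum_le_sum_abs _ _
    _ = ∑ t ∈ primeTriples x,
        Real.log x * |Real.log x ^ 3 * ratio t ^ α - 27 * (logWeight t * ratio t ^ α)| := by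
        rw [Finset.mul_sum]
    _ ≤ ∑ t ∈ primeTriples x, 2058 * (8 ^ 4 / η ^ 4) * (logWeight t * ratio t ^ (α - 4 * η) *
        (x / ((t.2.2 : ℝ) * t.2.1 * t.1)) ^ (1 / 2 : ℝ)) := by
        refine Finset.sum_le_sum fun t ht => ?_
        obtain ⟨h1, h2, h3, h4, h5, h6⟩ := mem_primeTriples.mp ht
        have r0 : (0 : ℝ) < t.1 := by exact_mod_cast h1.pos
        have q0 : (0 : ℝ) < t.2.1 := by exact_mod_cast h2.pos
        have p0 : (0 : ℝ) < t.2.2 := by exact_mod_cast h3.pos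
        have hn0 : (0 : ℝ) < (t.2.2 : ℝ) * t.2.1 * t.1 := by positivity
        have hρ : 0 < ratio t := div_pos p0 r0
        have hp2 : (2 : ℝ) ≤ t.2.2 := by exact_mod_cast h3.two_le
        have ha : 1 / 2 ≤ Real.log t.2.2 := by
          have := Real.log_le_log (by norm_num) hp2
          have := Real.log_two_gt_d9
          linarith
        have hab : Real.log t.2.2 ≤ Real.log t.2.1 :=
          Real.log_le_log p0 (by exact_mod_cast h5.le)
        have hbc : Real.log t.2.1 ≤ Real.log t.1 :=
          Real.log_le_log q0 (by exact_mod_cast h4.le)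
        have hlogn : Real.log ((t.2.2 : ℝ) * t.2.1 * t.1) =
            Real.log t.2.2 + Real.log t.2.1 + Real.log t.1 := by
          rw [Real.log_mul (by positivity) r0.ne', Real.log_mul p0.ne' q0.ne']
        have hsum : Real.log t.2.2 + Real.log t.2.1 + Real.log t.1 ≤ Real.log x := by
          rw [← hlogn]; exact Real.log_le_log hn0 h6
        have h := mul_abs_cube_sub_le ha hab hbc hsum
        rw [← hlogn, ← Real.log_div hx0.ne' hn0.ne', ← Real.log_div r0.ne' p0.ne'] at h
        have hv1 : 1 ≤ x / ((t.2.2 : ℝ) * t.2.1 * t.1) := by rwa [one_le_div hn0]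
        have hv2 : 1 ≤ (t.1 : ℝ) / t.2.2 := by
          rw [one_le_div p0]; exact_mod_cast (h5.trans h4).le
        have e1 : (1 + Real.log (x / ((t.2.2 : ℝ) * t.2.1 * t.1))) ^ 4 ≤
            8 ^ 4 * (x / ((t.2.2 : ℝ) * t.2.1 * t.1)) ^ (1 / 2 : ℝ) := by
          have h8 := one_add_log_le_rpow (η := 1 / 8) (by linarith : 0 < x / ((t.2.2 : ℝ) * t.2.1 * t.1))
            (by norm_num) (by norm_num)
          have := Real.log_nonneg hv1
          refine (pow_le_pow_left₀ (by linarith) h8 4).trans (le_of_eq ?_)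
          rw [div_pow, ← Real.rpow_mul_natCast (by positivity)]
          norm_num
          ring
        have e2 : (1 + Real.log ((t.1 : ℝ) / t.2.2)) ^ 4 ≤ ratio t ^ (-(4 * η)) / η ^ 4 := by
          have h8 := one_add_log_le_rpow (by linarith : 0 < (t.1 : ℝ) / t.2.2) hη0 hη1
          have := Real.log_nonneg hv2
          refine (pow_le_pow_left₀ (by linarith) h8 4).trans (le_of_eq ?_)
          rw [div_pow, ← Real.rpow_mul_natCast (by positivity), Real.rpow_neg hρ.le,
            ← Real.inv_rpow hρ.le, ratio, inv_div]
          congr 2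
          push_cast; ring
        have e3 : ratio t ^ (α - 4 * η) = ratio t ^ α * ratio t ^ (-(4 * η)) := by
          rw [← Real.rpow_add hρ]; congr 1
        have hrα : 0 ≤ ratio t ^ α := Real.rpow_nonneg hρ.le _
        have hlw := logWeight_nonneg t
        have hlogv := Real.log_nonneg hv2
        calc Real.log x * |Real.log x ^ 3 * ratio t ^ α - 27 * (logWeight t * ratio t ^ α)|
            = Real.log x * |Real.log x ^ 3 - 27 * logWeight t| * ratio t ^ α := by
              rw [mul_assoc]
              congr 1
              nth_rewrite 3 [← abs_of_nonneg hrα]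
              rw [← abs_mul]; congr 1; ring
          _ ≤ 2058 * logWeight t * ((8 ^ 4 * (x / ((t.2.2 : ℝ) * t.2.1 * t.1)) ^ (1 / 2 : ℝ)) *
              (ratio t ^ (-(4 * η)) / η ^ 4)) * ratio t ^ α := by
              refine mul_le_mul_of_nonneg_right (h.trans ?_) hrα
              rw [show Real.log t.2.2 * Real.log t.2.1 * Real.log t.1 = logWeight t from rfl]
              gcongr
          _ = _ := by rw [e3]; ring
    _ = 2058 * (8 ^ 4 / η ^ 4) * ∑ t ∈ primeTriples x, (logWeight t * ratio t ^ (α - 4 * η) *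
        (x / ((t.2.2 : ℝ) * t.2.1 * t.1)) ^ (1 / 2 : ℝ)) := by rw [Finset.mul_sum]
    _ ≤ 2058 * (8 ^ 4 / η ^ 4) * (4 * C * x) := by gcongr
    _ = _ := by ring

end RemovingLogarithms

section Conversion

lemma Finset.exists_lt_lt_of_card_eq_three {s : Finset ℕ} (hs : s.card = 3) :
    ∃ p q r, p < q ∧ q < r ∧ s = {p, q, r} := by
  obtain ⟨a, b, c, hab, hac, hbc, rfl⟩ := Finset.card_eq_three.mp hs
  rcases lt_or_gt_of_ne hab with h1 | h1 <;> rcases lt_or_gt_of_ne hac with h2 | h2 <;>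
    rcases lt_or_gt_of_ne hbc with h3 | h3
  · exact ⟨a, b, c, h1, h3, rfl⟩
  · exact ⟨a, c, b, h2, h3, by ext; simp; tauto⟩
  · lia
  · exact ⟨c, a, b, h2, h1, by ext; simp; tauto⟩
  · exact ⟨b, a, c, h1, h2, by ext; simp; tauto⟩
  · lia
  · exact ⟨b, c, a, h3, h2, by ext; simp; tauto⟩
  · exact ⟨c, b, a, h3, h1, by ext; simp; tauto⟩


lemma primeFactors_mul_mul {p q r : ℕ} (hp : p.Prime) (hq : q.Prime) (hr : r.Prime) :
    (p * q * r).primeFactors = {p, q, r} := by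
  rw [Nat.primeFactors_mul (mul_ne_zero hp.ne_zero hq.ne_zero) hr.ne_zero,
    Nat.primeFactors_mul hp.ne_zero hq.ne_zero, hp.primeFactors, hq.primeFactors, hr.primeFactors]
  ext; simp

lemma sup_primeFactors_mul_mul {p q r : ℕ} (hp : p.Prime) (hq : q.Prime) (hr : r.Prime)
    (hpq : p < q) (hqr : q < r) : (p * q * r).primeFactors.sup id = r := by
  rw [primeFactors_mul_mul hp hq hr]
  simp; lia

lemma minFac_mul_mul {p q r : ℕ} (hp : p.Prime) (hq : q.Prime) (hr : r.Prime)
    (hpq : p < q) (hqr : q < r) : (p * q * r).minFac = p := by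
  have h1 : p * q * r ≠ 1 := by
    intro h
    exact hr.one_lt.ne' (Nat.eq_one_of_mul_eq_one_left h)
  have h2 := Nat.minFac_prime h1
  have h3 : (p * q * r).minFac ∈ (p * q * r).primeFactors :=
    Nat.mem_primeFactors.mpr ⟨h2, Nat.minFac_dvd _, by
      have := hp.pos; have := hq.pos; have := hr.pos; positivity⟩
  have h4 : (p * q * r).minFac ≤ p := Nat.minFac_le_of_dvd hp.two_le ⟨q * r, by ring⟩
  rw [primeFactors_mul_mul hp hq hr] at h3
  simp only [Finset.mem_insert, Finset.mem_singleton] at h3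
  lia

lemma squarefree_mul_mul {p q r : ℕ} (hp : p.Prime) (hq : q.Prime) (hr : r.Prime)
    (hpq : p < q) (hqr : q < r) : Squarefree (p * q * r) := by
  have c1 : Nat.Coprime p q := (Nat.coprime_primes hp hq).mpr hpq.ne
  have c2 : Nat.Coprime (p * q) r := Nat.Coprime.mul_left
    ((Nat.coprime_primes hp hr).mpr (hpq.trans hqr).ne) ((Nat.coprime_primes hq hr).mpr hqr.ne)
  rw [Nat.squarefree_mul c2, Nat.squarefree_mul c1]
  exact ⟨⟨hp.prime.squarefree, hq.prime.squarefree⟩, hr.prime.squarefree⟩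

lemma ratioSum_eq_sum_squarefree (α x : ℝ) :
    ratioSum α x = ∑ n ∈ (Finset.Icc 2 ⌊x⌋₊).filter
            (fun n => Squarefree n ∧ n.primeFactors.card = 3),
          ((n.minFac : ℝ) / ((n.primeFactors.sup id : ℕ) : ℝ)) ^ α := by
  refine Finset.sum_nbij (fun t => t.2.2 * t.2.1 * t.1) ?_ ?_ ?_ ?_
  · intro t ht
    obtain ⟨hr, hq, hp, hqr, hpq, hx⟩ := mem_primeTriples.mp ht
    rw [Finset.mem_filter, Finset.mem_Icc]
    have h2 : 2 ≤ t.2.2 * t.2.1 * t.1 := by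
      have := hp.two_le; have := hq.pos; have := hr.pos
      calc 2 = 2 * 1 * 1 := by norm_num
        _ ≤ t.2.2 * t.2.1 * t.1 := by gcongr <;> lia
    refine ⟨⟨h2, ?_⟩, squarefree_mul_mul hp hq hr hpq hqr, ?_⟩
    · rw [Nat.le_floor_iff' (by lia)]; push_cast; exact hx
    · rw [primeFactors_mul_mul hp hq hr]
      exact Finset.card_eq_three.mpr ⟨_, _, _, hpq.ne, (hpq.trans hqr).ne, hqr.ne, rfl⟩
  · rintro ⟨r, q, p⟩ ht ⟨r', q', p'⟩ ht' h
    obtain ⟨hr, hq, hp, hqr, hpq, -⟩ := mem_primeTriples.mp ht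
    obtain ⟨hr', hq', hp', hqr', hpq', -⟩ := mem_primeTriples.mp ht'
    simp only at hr hq hp hqr hpq hr' hq' hp' hqr' hpq' h
    have e1 : p = p' := by
      rw [← minFac_mul_mul hp hq hr hpq hqr, ← minFac_mul_mul hp' hq' hr' hpq' hqr', h]
    have e2 : r = r' := by
      rw [← sup_primeFactors_mul_mul hp hq hr hpq hqr,
        ← sup_primeFactors_mul_mul hp' hq' hr' hpq' hqr', h]
    subst e1 e2
    have e3 : q = q' :=
      Nat.eq_of_mul_eq_mul_left hp.pos (Nat.eq_of_mul_eq_mul_right hr.pos h)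
    rw [e3]
  · intro n hn
    obtain ⟨h1, hsq, hcard⟩ := Finset.mem_filter.mp (Finset.mem_coe.mp hn)
    rw [Finset.mem_Icc] at h1
    obtain ⟨p, q, r, hpq, hqr, hs⟩ := Finset.exists_lt_lt_of_card_eq_three hcard
    have hmem : ∀ m ∈ ({p, q, r} : Finset ℕ), m.Prime := fun m hm =>
      Nat.prime_of_mem_primeFactors (hs ▸ hm)
    have hprod : p * q * r = n := by
      rw [← Nat.prod_primeFactors_of_squarefree hsq, hs, Finset.prod_insert, Finset.prod_pair hqr.ne,
        mul_assoc]
      simp; lia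
    refine ⟨(r, q, p), mem_primeTriples.mpr ⟨hmem r (by simp), hmem q (by simp), hmem p (by simp),
      hqr, hpq, ?_⟩, hprod⟩
    have := (Nat.le_floor_iff' (by lia)).mp h1.2
    rw [← hprod] at this
    push_cast at this
    exact this
  · intro t ht
    obtain ⟨hr, hq, hp, hqr, hpq, -⟩ := mem_primeTriples.mp ht
    rw [minFac_mul_mul hp hq hr hpq hqr, sup_primeFactors_mul_mul hp hq hr hpq hqr, ratio]

end Conversion

/-- For `α > 0`, the sum over squarefree `n ≤ x` with exactly three prime factors satisfies
`Σ^{(3)}(x) = (9/α²)·x/log³x + O(x/log⁴x)`. -/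
theorem squarefree_three_prime_factors_ratio_sum
    (α : ℝ) (hα : 0 < α) :
    (fun x : ℝ =>
        (∑ n ∈ (Finset.Icc 2 ⌊x⌋₊).filter
            (fun n => Squarefree n ∧ n.primeFactors.card = 3),
          ((n.minFac : ℝ) / ((n.primeFactors.sup id : ℕ) : ℝ)) ^ α)
        - (9 / α ^ 2) * (x / Real.log x ^ 3))
      =O[atTop] (fun x : ℝ => x / Real.log x ^ 4) := by
  obtain ⟨C, hC⟩ := exists_abs_ratioSum_sub_logTripleSum_le hα
  obtain ⟨K, x₀, hx₀, hK⟩ := exists_abs_logTripleSum_sub_le hα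
  refine Asymptotics.IsBigO.of_bound (C + 27 * K) ?_
  filter_upwards [eventually_ge_atTop x₀] with x hx
  have hx1 : 1 < x := by linarith
  have hL : 0 < Real.log x := Real.log_pos hx1
  have h1 := hC x hx1
  have h2 := hK x hx
  rw [← ratioSum_eq_sum_squarefree, Real.norm_eq_abs, Real.norm_of_nonneg (by positivity)]
  generalize Real.log x = L at *
  have e : ratioSum α x - 9 / α ^ 2 * (x / L ^ 3) =
      L * ((L ^ 3 * ratioSum α x - 27 * logTripleSum α x) +
        27 * (logTripleSum α x - x / (3 * α ^ 2))) / L ^ 4 := by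
    field_simp; ring
  rw [e, abs_div, abs_of_pos (by positivity : 0 < L ^ 4), abs_mul, abs_of_pos hL, mul_div_assoc']
  refine div_le_div_of_nonneg_right ?_ (by positivity)
  rw [le_div_iff₀ hL] at h2
  have h3 := mul_le_mul_of_nonneg_left (abs_add_le (L ^ 3 * ratioSum α x - 27 * logTripleSum α x)
    (27 * (logTripleSum α x - x / (3 * α ^ 2)))) hL.le
  rw [abs_mul, abs_of_pos (by norm_num : (0 : ℝ) < 27)] at h3
  linarith
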